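/- arXiv:2210.06119 — 14 statements merged into one kernel-verified Lean document; each statement's English description precedes it below -/
import Mathlib

section
/- The mass-action system ẋ = x(κ₁z − κ₂y), ẏ = y(κ₂x − κ₃z), ż = z(−κ₃y − κ₁x) + 2κ₄ with positive rate constants κ₁, κ₂, κ₃, κ₄ has exactly one equilibrium in the open positive orthant ℝ³₊, namely (x*, y*, z*) = (√(κ₃κ₄/(κ₁κ₂)), √(κ₁κ₄/(κ₂κ₃)), √(κ₂κ₄/(κ₁κ₃))). That is, for (x,y,z) ∈ ℝ³₊, the right-hand side vanishes if and only if (x,y,z) = (x*, y*, z*). -/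
/-- The mass-action system ẋ = x(κ₁z − κ₂y), ẏ = y(κ₂x − κ₃z), ż = z(−κ₃y − κ₁x) + 2κ₄
with positive rate constants has exactly one equilibrium in the open positive orthant,
namely (√(κ₃κ₄/(κ₁κ₂)), √(κ₁κ₄/(κ₂κ₃)), √(κ₂κ₄/(κ₁κ₃))). -/
theorem unique_positive_equilibrium
    (κ₁ κ₂ κ₃ κ₄ : ℝ) (hκ₁ : 0 < κ₁) (hκ₂ : 0 < κ₂) (hκ₃ : 0 < κ₃) (hκ₄ : 0 < κ₄)
    (x y z : ℝ) (hx : 0 < x) (hy : 0 < y) (hz : 0 < z) :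
    (x * (κ₁ * z - κ₂ * y) = 0 ∧
     y * (κ₂ * x - κ₃ * z) = 0 ∧
     z * (-(κ₃ * y) - κ₁ * x) + 2 * κ₄ = 0) ↔
    (x, y, z) = (Real.sqrt (κ₃ * κ₄ / (κ₁ * κ₂)),
                 Real.sqrt (κ₁ * κ₄ / (κ₂ * κ₃)),
                 Real.sqrt (κ₂ * κ₄ / (κ₁ * κ₃))) := by
  have e1 : x = Real.sqrt (κ₃ * κ₄ / (κ₁ * κ₂)) ↔ x * x * (κ₁ * κ₂) = κ₃ * κ₄ := by
    rw [eq_comm, Real.sqrt_eq_iff_mul_self_eq_of_pos hx, eq_div_iff (by positivity)]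
  have e2 : y = Real.sqrt (κ₁ * κ₄ / (κ₂ * κ₃)) ↔ y * y * (κ₂ * κ₃) = κ₁ * κ₄ := by
    rw [eq_comm, Real.sqrt_eq_iff_mul_self_eq_of_pos hy, eq_div_iff (by positivity)]
  have e3 : z = Real.sqrt (κ₂ * κ₄ / (κ₁ * κ₃)) ↔ z * z * (κ₁ * κ₃) = κ₂ * κ₄ := by
    rw [eq_comm, Real.sqrt_eq_iff_mul_self_eq_of_pos hz, eq_div_iff (by positivity)]
  rw [Prod.mk.injEq, Prod.mk.injEq, e1, e2, e3]
  constructor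
  · rintro ⟨h1, h2, h3⟩
    have a1 : κ₁ * z - κ₂ * y = 0 := (mul_eq_zero.mp h1).resolve_left hx.ne'
    have a2 : κ₂ * x - κ₃ * z = 0 := (mul_eq_zero.mp h2).resolve_left hy.ne'
    have a3 : z * z * (κ₁ * κ₃) = κ₂ * κ₄ := by
      linear_combination (z * κ₃ / 2) * a1 - (z * κ₁ / 2) * a2 - (κ₂ / 2) * h3
    refine ⟨?_, ?_, a3⟩
    · apply mul_left_cancel₀ hκ₂.ne'
      linear_combination (κ₁ * (κ₂ * x + κ₃ * z)) * a2 + κ₃ * a3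
    · apply mul_left_cancel₀ hκ₂.ne'
      linear_combination -(κ₃ * (κ₂ * y + κ₁ * z)) * a1 + κ₁ * a3
  · rintro ⟨h1, h2, h3⟩
    have a1 : κ₁ * z - κ₂ * y = 0 := by
      have : (κ₃ * (κ₁ * z + κ₂ * y)) * (κ₁ * z - κ₂ * y) = 0 := by
        linear_combination κ₁ * h3 - κ₂ * h2
      exact (mul_eq_zero.mp this).resolve_left (by positivity)
    have a2 : κ₂ * x - κ₃ * z = 0 := by
      have : (κ₁ * (κ₂ * x + κ₃ * z)) * (κ₂ * x - κ₃ * z) = 0 := by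
        linear_combination κ₂ * h1 - κ₃ * h3
      exact (mul_eq_zero.mp this).resolve_left (by positivity)
    refine ⟨by rw [a1, mul_zero], by rw [a2, mul_zero], ?_⟩
    apply mul_left_cancel₀ hκ₂.ne'
    linear_combination (z * κ₃) * a1 - (z * κ₁) * a2 - 2 * h3
end

section
/- Let J be the Jacobian matrix of the right-hand side of the mass-action system ẋ = x(κ₁z − κ₂y), ẏ = y(κ₂x − κ₃z), ż = z(−κ₃y − κ₁x) + 2κ₄ evaluated at the positive equilibrium (x*, y*, z*) = (√(κ₃κ₄/(κ₁κ₂)), √(κ₁κ₄/(κ₂κ₃)), √(κ₂κ₄/(κ₁κ₃))). Then the characteristic polynomial of J equals λ³ + a₂λ² + a₁λ + a₀ with a₂ = 2√(κ₁κ₃κ₄/κ₂), a₁ = (κ₁ + κ₂ − κ₃)κ₄, and a₀ = 4√(κ₁κ₂κ₃κ₄³). -/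
open Polynomial

/-- The right-hand side of the mass-action system
ẋ = x(κ₁z − κ₂y), ẏ = y(κ₂x − κ₃z), ż = z(−κ₃y − κ₁x) + 2κ₄, as a vector field on ℝ³. -/
noncomputable def massActionField (κ₁ κ₂ κ₃ κ₄ : ℝ) (v : Fin 3 → ℝ) : Fin 3 → ℝ :=
  ![v 0 * (κ₁ * v 2 - κ₂ * v 1),
    v 1 * (κ₂ * v 0 - κ₃ * v 2),
    v 2 * (-(κ₃ * v 1) - κ₁ * v 0) + 2 * κ₄]

/-- The Jacobian matrix (the matrix of partial derivatives) of the right-hand side of the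
mass-action system, evaluated at the positive equilibrium
(√(κ₃κ₄/(κ₁κ₂)), √(κ₁κ₄/(κ₂κ₃)), √(κ₂κ₄/(κ₁κ₃))). -/
noncomputable def jacobianAtEq (κ₁ κ₂ κ₃ κ₄ : ℝ) : Matrix (Fin 3) (Fin 3) ℝ := fun i j =>
  fderiv ℝ (massActionField κ₁ κ₂ κ₃ κ₄)
    ![Real.sqrt (κ₃ * κ₄ / (κ₁ * κ₂)), Real.sqrt (κ₁ * κ₄ / (κ₂ * κ₃)),
      Real.sqrt (κ₂ * κ₄ / (κ₁ * κ₃))] (Pi.single j 1) i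

theorem hasFDerivAt_field (κ₁ κ₂ κ₃ κ₄ : ℝ) (v w : Fin 3 → ℝ) :
    fderiv ℝ (massActionField κ₁ κ₂ κ₃ κ₄) v w =
    ![w 0 * (κ₁ * v 2 - κ₂ * v 1) + v 0 * (κ₁ * w 2 - κ₂ * w 1),
      w 1 * (κ₂ * v 0 - κ₃ * v 2) + v 1 * (κ₂ * w 0 - κ₃ * w 2),
      w 2 * (-(κ₃ * v 1) - κ₁ * v 0) + v 2 * (-(κ₃ * w 1) - κ₁ * w 0)] := by
  have p : ∀ i : Fin 3, HasFDerivAt (fun v : Fin 3 → ℝ => v i)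
      (ContinuousLinearMap.proj (R := ℝ) (φ := fun _ : Fin 3 => ℝ) i) v :=
    fun i => hasFDerivAt_apply i v
  have h0 := (p 0).mul (((p 2).const_mul κ₁).sub ((p 1).const_mul κ₂))
  have h1 := (p 1).mul (((p 0).const_mul κ₂).sub ((p 2).const_mul κ₃))
  have h2 := ((p 2).mul ((((p 1).const_mul κ₃).neg).sub ((p 0).const_mul κ₁))).add_const (2 * κ₄)
  have gen : ∀ L0 L1 L2 : (Fin 3 → ℝ) →L[ℝ] ℝ,
      HasFDerivAt (fun v : Fin 3 → ℝ => v 0 * (κ₁ * v 2 - κ₂ * v 1)) L0 v →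
      HasFDerivAt (fun v : Fin 3 → ℝ => v 1 * (κ₂ * v 0 - κ₃ * v 2)) L1 v →
      HasFDerivAt (fun v : Fin 3 → ℝ => v 2 * (-(κ₃ * v 1) - κ₁ * v 0) + 2 * κ₄) L2 v →
      HasFDerivAt (massActionField κ₁ κ₂ κ₃ κ₄)
        (ContinuousLinearMap.pi (![L0, L1, L2] : Fin 3 → (Fin 3 → ℝ) →L[ℝ] ℝ)) v := by
    intro L0 L1 L2 h0 h1 h2
    rw [hasFDerivAt_pi']
    intro i
    fin_cases i
    · exact h0
    · exact h1
    · exact h2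
  have key := gen _ _ _ h0 h1 h2
  rw [key.fderiv]
  ext i
  fin_cases i <;> simp <;> ring

/-- The characteristic polynomial of the Jacobian at the positive equilibrium is
λ³ + a₂λ² + a₁λ + a₀ with a₂ = 2√(κ₁κ₃κ₄/κ₂), a₁ = (κ₁+κ₂−κ₃)κ₄, a₀ = 4√(κ₁κ₂κ₃κ₄³). -/
theorem charpoly_jacobianAtEq
    (κ₁ κ₂ κ₃ κ₄ : ℝ) (hκ₁ : 0 < κ₁) (hκ₂ : 0 < κ₂) (hκ₃ : 0 < κ₃) (hκ₄ : 0 < κ₄) :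
    (jacobianAtEq κ₁ κ₂ κ₃ κ₄).charpoly =
      X ^ 3 + C (2 * Real.sqrt (κ₁ * κ₃ * κ₄ / κ₂)) * X ^ 2
        + C ((κ₁ + κ₂ - κ₃) * κ₄) * X
        + C (4 * Real.sqrt (κ₁ * κ₂ * κ₃ * κ₄ ^ 3)) := by
  obtain ⟨t, ht, ht2⟩ : ∃ t : ℝ, 0 < t ∧ κ₄ = κ₁ * κ₂ * κ₃ * t ^ 2 := by
    refine ⟨Real.sqrt (κ₄ / (κ₁ * κ₂ * κ₃)), by positivity, ?_⟩
    rw [Real.sq_sqrt (by positivity)]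
    field_simp
  have sq : ∀ a b : ℝ, 0 ≤ b → a = b ^ 2 → Real.sqrt a = b := by
    intro a b hb h
    rw [h, Real.sqrt_sq hb]
  have e1 : Real.sqrt (κ₃ * κ₄ / (κ₁ * κ₂)) = κ₃ * t :=
    sq _ _ (by positivity) (by rw [ht2]; field_simp)
  have e2 : Real.sqrt (κ₁ * κ₄ / (κ₂ * κ₃)) = κ₁ * t :=
    sq _ _ (by positivity) (by rw [ht2]; field_simp)
  have e3 : Real.sqrt (κ₂ * κ₄ / (κ₁ * κ₃)) = κ₂ * t :=
    sq _ _ (by positivity) (by rw [ht2]; field_simp)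
  have e4 : Real.sqrt (κ₁ * κ₃ * κ₄ / κ₂) = κ₁ * κ₃ * t :=
    sq _ _ (by positivity) (by rw [ht2]; field_simp)
  have e5 : Real.sqrt (κ₁ * κ₂ * κ₃ * κ₄ ^ 3) = (κ₁ * κ₂ * κ₃) ^ 2 * t ^ 3 :=
    sq _ _ (by positivity) (by rw [ht2]; ring)
  have hJ : jacobianAtEq κ₁ κ₂ κ₃ κ₄ =
      !![0, -(κ₂ * (κ₃ * t)), κ₁ * (κ₃ * t);
         κ₂ * (κ₁ * t), 0, -(κ₃ * (κ₁ * t));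
         -(κ₁ * (κ₂ * t)), -(κ₃ * (κ₂ * t)), -(2 * κ₁ * κ₃ * t)] := by
    ext i j
    simp only [jacobianAtEq, hasFDerivAt_field, e1, e2, e3]
    fin_cases i <;> fin_cases j <;> simp <;> ring
  rw [hJ, e4, e5, ht2, Matrix.charpoly, Matrix.det_fin_three]
  have c2 : (C 2 : ℝ[X]) = 2 := rfl
  have c4 : (C 4 : ℝ[X]) = 4 := rfl
  simp [c2, c4]
  ring
end

section
/- Let κ₁, κ₂, κ₃, κ₄ > 0 with κ₁ = κ₂ + κ₃. Then the complex roots of the polynomial λ³ + a₂λ² + a₁λ + a₀, where a₂ = 2√(κ₁κ₃κ₄/κ₂), a₁ = (κ₁ + κ₂ − κ₃)κ₄, a₀ = 4√(κ₁κ₂κ₃κ₄³), are exactly the pair of purely imaginary numbers ±iω with ω = √(2κ₂κ₄) and one negative real number (namely −a₂). In particular, the Jacobian of system (2) at the positive equilibrium has a pair of purely imaginary eigenvalues ±i√(2κ₂κ₄) and one negative real eigenvalue. -/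
theorem aux_jac (κ₁ κ₂ κ₃ κ₄ : ℝ) (v : Fin 3 → ℝ) (i j : Fin 3) :
    fderiv ℝ (massActionField κ₁ κ₂ κ₃ κ₄) v (Pi.single j 1) i =
    (!![κ₁ * v 2 - κ₂ * v 1, -(κ₂ * v 0), κ₁ * v 0;
       κ₂ * v 1, κ₂ * v 0 - κ₃ * v 2, -(κ₃ * v 1);
       -(κ₁ * v 2), -(κ₃ * v 2), -(κ₃ * v 1) - κ₁ * v 0] : Matrix (Fin 3) (Fin 3) ℝ) i j := by
  have h (k : Fin 3) : HasFDerivAt (fun v : Fin 3 → ℝ => v k)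
      (ContinuousLinearMap.proj (R := ℝ) (φ := fun _ : Fin 3 => ℝ) k) v := hasFDerivAt_apply k v
  have h0 := (h 0).mul (((h 2).const_mul κ₁).sub ((h 1).const_mul κ₂))
  have h1 := (h 1).mul (((h 0).const_mul κ₂).sub ((h 2).const_mul κ₃))
  have h2 := ((h 2).mul ((((h 1).const_mul κ₃).neg).sub ((h 0).const_mul κ₁))).add_const (2 * κ₄)
  have hd : DifferentiableAt ℝ (massActionField κ₁ κ₂ κ₃ κ₄) v := by
    rw [differentiableAt_pi]
    intro i
    fin_cases i
    · exact h0.differentiableAt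
    · exact h1.differentiableAt
    · exact h2.differentiableAt
  have hp := hasFDerivAt_pi'.1 hd.hasFDerivAt
  have e0 := (hp 0).unique h0
  have e1 := (hp 1).unique h1
  have e2 := (hp 2).unique h2
  have e0 := DFunLike.congr_fun e0 (Pi.single j 1)
  have e1 := DFunLike.congr_fun e1 (Pi.single j 1)
  have e2 := DFunLike.congr_fun e2 (Pi.single j 1)
  fin_cases i
  · refine Eq.trans e0 ?_
    fin_cases j <;> simp <;> ring
  · refine Eq.trans e1 ?_
    fin_cases j <;> simp <;> ring
  · refine Eq.trans e2 ?_
    fin_cases j <;> simp <;> ring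

/-- If κ₁ = κ₂ + κ₃, the complex roots of λ³ + a₂λ² + a₁λ + a₀ (with
a₂ = 2√(κ₁κ₃κ₄/κ₂), a₁ = (κ₁+κ₂−κ₃)κ₄, a₀ = 4√(κ₁κ₂κ₃κ₄³)) are exactly ±iω with
ω = √(2κ₂κ₄) together with the negative real number −a₂.  In particular, the Jacobian of
system (2) at the positive equilibrium has the pair of purely imaginary eigenvalues
±i√(2κ₂κ₄) and the negative real eigenvalue −a₂. -/
theorem roots_center_case
    (κ₁ κ₂ κ₃ κ₄ : ℝ) (hκ₁ : 0 < κ₁) (hκ₂ : 0 < κ₂) (hκ₃ : 0 < κ₃) (hκ₄ : 0 < κ₄)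
    (heq : κ₁ = κ₂ + κ₃) :
    (∀ lam : ℂ,
      lam ^ 3 + (2 * Real.sqrt (κ₁ * κ₃ * κ₄ / κ₂) : ℝ) * lam ^ 2
        + ((κ₁ + κ₂ - κ₃) * κ₄ : ℝ) * lam
        + (4 * Real.sqrt (κ₁ * κ₂ * κ₃ * κ₄ ^ 3) : ℝ) = 0 ↔
      (lam = Complex.I * (Real.sqrt (2 * κ₂ * κ₄) : ℝ) ∨
       lam = -(Complex.I * (Real.sqrt (2 * κ₂ * κ₄) : ℝ)) ∨
       lam = -(2 * Real.sqrt (κ₁ * κ₃ * κ₄ / κ₂) : ℝ))) ∧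
    -(2 * Real.sqrt (κ₁ * κ₃ * κ₄ / κ₂)) < 0 ∧
    Complex.I * (Real.sqrt (2 * κ₂ * κ₄) : ℝ) ∈
      spectrum ℂ ((jacobianAtEq κ₁ κ₂ κ₃ κ₄).map (Complex.ofReal ·)) ∧
    -(Complex.I * (Real.sqrt (2 * κ₂ * κ₄) : ℝ)) ∈
      spectrum ℂ ((jacobianAtEq κ₁ κ₂ κ₃ κ₄).map (Complex.ofReal ·)) ∧
    (-(2 * Real.sqrt (κ₁ * κ₃ * κ₄ / κ₂) : ℝ) : ℂ) ∈
      spectrum ℂ ((jacobianAtEq κ₁ κ₂ κ₃ κ₄).map (Complex.ofReal ·)) := by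
  have hs : 0 < Real.sqrt (κ₁ * κ₃ * κ₄ / κ₂) := Real.sqrt_pos.2 (by positivity)
  have hs2 : Real.sqrt (κ₁ * κ₃ * κ₄ / κ₂) ^ 2 = κ₁ * κ₃ * κ₄ / κ₂ := Real.sq_sqrt (by positivity)
  have hw2 : Real.sqrt (2 * κ₂ * κ₄) ^ 2 = 2 * κ₂ * κ₄ := Real.sq_sqrt (by positivity)
  have ha0 : Real.sqrt (κ₁ * κ₂ * κ₃ * κ₄ ^ 3) = κ₂ * κ₄ * Real.sqrt (κ₁ * κ₃ * κ₄ / κ₂) := by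
    rw [Real.sqrt_eq_iff_mul_self_eq (by positivity) (by positivity)]
    rw [← sq, mul_pow, hs2]
    field_simp
  have hx : Real.sqrt (κ₃ * κ₄ / (κ₁ * κ₂)) = Real.sqrt (κ₁ * κ₃ * κ₄ / κ₂) / κ₁ := by
    rw [Real.sqrt_eq_iff_mul_self_eq (by positivity) (by positivity), ← sq, div_pow, hs2]
    field_simp
  have hy : Real.sqrt (κ₁ * κ₄ / (κ₂ * κ₃)) = Real.sqrt (κ₁ * κ₃ * κ₄ / κ₂) / κ₃ := by
    rw [Real.sqrt_eq_iff_mul_self_eq (by positivity) (by positivity), ← sq, div_pow, hs2]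
    field_simp
  have hz : Real.sqrt (κ₂ * κ₄ / (κ₁ * κ₃)) =
      κ₂ * Real.sqrt (κ₁ * κ₃ * κ₄ / κ₂) / (κ₁ * κ₃) := by
    rw [Real.sqrt_eq_iff_mul_self_eq (by positivity) (by positivity), ← sq, div_pow, mul_pow, hs2]
    field_simp
  have hJ : jacobianAtEq κ₁ κ₂ κ₃ κ₄ = _ :=
    funext fun i => funext fun j => aux_jac κ₁ κ₂ κ₃ κ₄ _ i j
  rw [hx, hy, hz] at hJ
  rw [ha0, hJ]
  clear hJ hx hy hz ha0
  generalize Real.sqrt (κ₁ * κ₃ * κ₄ / κ₂) = s at *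
  generalize Real.sqrt (2 * κ₂ * κ₄) = w at *
  have h1c : (κ₁ : ℂ) ≠ 0 := by exact_mod_cast hκ₁.ne'
  have h2c : (κ₂ : ℂ) ≠ 0 := by exact_mod_cast hκ₂.ne'
  have h3c : (κ₃ : ℂ) ≠ 0 := by exact_mod_cast hκ₃.ne'
  have hec : (κ₁ : ℂ) = κ₂ + κ₃ := by exact_mod_cast heq
  have hwc : (w : ℂ) ^ 2 = 2 * κ₂ * κ₄ := by exact_mod_cast hw2
  have hsc : (κ₂ : ℂ) * s ^ 2 = κ₁ * κ₃ * κ₄ := by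
    have : κ₂ * s ^ 2 = κ₁ * κ₃ * κ₄ := by rw [hs2]; field_simp
    exact_mod_cast this
  have hfac (lam : ℂ) : lam ^ 3 + (2 * s : ℝ) * lam ^ 2 + ((κ₁ + κ₂ - κ₃) * κ₄ : ℝ) * lam
        + (4 * (κ₂ * κ₄ * s) : ℝ) =
        (lam - Complex.I * w) * ((lam + Complex.I * w) * (lam + 2 * s)) := by
    push_cast
    linear_combination (κ₄ * lam) * hec - (lam + 2 * s) * hwc
      + (w : ℂ) ^ 2 * (lam + 2 * s) * Complex.I_sq
  have hroots : ∀ lam : ℂ, lam ^ 3 + (2 * s : ℝ) * lam ^ 2 + ((κ₁ + κ₂ - κ₃) * κ₄ : ℝ) * lam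
        + (4 * (κ₂ * κ₄ * s) : ℝ) = 0 ↔ (lam = Complex.I * (w : ℝ) ∨
       lam = -(Complex.I * (w : ℝ)) ∨ lam = -(2 * s : ℝ)) := by
    intro lam
    rw [hfac, mul_eq_zero, mul_eq_zero, sub_eq_zero, add_eq_zero_iff_eq_neg,
      add_eq_zero_iff_eq_neg]
    push_cast
    rfl
  have key (lam : ℂ) (h : lam ^ 3 + (2 * s : ℝ) * lam ^ 2 + ((κ₁ + κ₂ - κ₃) * κ₄ : ℝ) * lam
        + (4 * (κ₂ * κ₄ * s) : ℝ) = 0) (M : Matrix (Fin 3) (Fin 3) ℝ)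
      (hM : M = !![0, -(κ₂ * (s / κ₁)), s; κ₂ * (s / κ₃), 0, -s;
        -(κ₂ * s / κ₃), -(κ₂ * s / κ₁), -(2 * s)]) :
      lam ∈ spectrum ℂ (M.map (Complex.ofReal ·)) := by
    rw [spectrum.mem_iff, Matrix.isUnit_iff_isUnit_det, isUnit_iff_ne_zero, not_not, ← h, hM,
      Matrix.det_fin_three]
    simp [Matrix.algebraMap_matrix_apply]
    have hk4 : (κ₄ : ℂ) = κ₂ * s ^ 2 / (κ₁ * κ₃) := by
      rw [hsc]; field_simp
    rw [hk4]
    have hk : (κ₃ : ℂ) = κ₁ - κ₂ := by rw [hec]; ring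
    field_simp
    rw [hec]
    ring
  refine ⟨hroots, by linarith, key _ ((hroots _).2 (Or.inl rfl)) _ ?_,
    key _ ((hroots _).2 (Or.inr (Or.inl rfl))) _ ?_,
    key _ ((hroots _).2 (Or.inr (Or.inr (by push_cast; rfl)))) _ ?_⟩ <;>
  · ext i j
    fin_cases i <;> fin_cases j <;> simp <;> field_simp <;> ring
end

section
/- Let κ₁, κ₂, κ₃, κ₄ > 0 with κ₁ < κ₂ + κ₃. Then the polynomial λ³ + a₂λ² + a₁λ + a₀, where a₂ = 2√(κ₁κ₃κ₄/κ₂), a₁ = (κ₁ + κ₂ − κ₃)κ₄, a₀ = 4√(κ₁κ₂κ₃κ₄³), has a complex root with positive real part. In particular, the Jacobian of system (2) at the positive equilibrium has an eigenvalue with positive real part. -/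
theorem cubic_root_aux (a b c : ℝ) (ha : 0 < a) (hc : 0 < c) (h : a * b < c) :
    ∃ lam : ℂ, lam ^ 3 + (a : ℂ) * lam ^ 2 + (b : ℂ) * lam + (c : ℂ) = 0 ∧ 0 < lam.re := by
  obtain ⟨r, hr, hr0⟩ : ∃ r : ℝ, r < -a ∧ r ^ 3 + a * r ^ 2 + b * r + c = 0 := by
    set M : ℝ := a + |b| + c + 1 with hM
    have hb := abs_nonneg b
    have hb1 := neg_abs_le b
    have hM1 : 1 ≤ M := by linarith
    have hcont : ContinuousOn (fun r : ℝ => r ^ 3 + a * r ^ 2 + b * r + c) (Set.Icc (-M) (-a)) := by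
      fun_prop
    have hle : -M ≤ -a := by linarith
    have hlow : (-M) ^ 3 + a * (-M) ^ 2 + b * (-M) + c < 0 := by
      have e : (-M) ^ 3 + a * (-M) ^ 2 + b * (-M) + c
          = -M ^ 2 * (|b| + c + 1) - b * M + c := by
        have : M - a = |b| + c + 1 := by rw [hM]; ring
        rw [← this]; ring
      rw [e]
      have h1 : M ≤ M ^ 2 := by nlinarith
      have h2 : |b| * M ≤ |b| * M ^ 2 := mul_le_mul_of_nonneg_left h1 hb
      have h3 : c * 1 ≤ c * M ^ 2 := mul_le_mul_of_nonneg_left (by linarith) hc.le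
      have h4 : -b * M ≤ |b| * M := mul_le_mul_of_nonneg_right (by linarith) (by linarith)
      nlinarith
    have hhigh : 0 < (-a) ^ 3 + a * (-a) ^ 2 + b * (-a) + c := by nlinarith
    obtain ⟨r, hr, hr0⟩ := intermediate_value_Icc hle hcont ⟨hlow.le, hhigh.le⟩
    refine ⟨r, lt_of_le_of_ne hr.2 ?_, hr0⟩
    rintro rfl
    simp only at hr0
    linarith
  obtain ⟨s, hs⟩ : ∃ s : ℂ, s ^ 2 = ((a + r : ℝ) : ℂ) ^ 2 - 4 * ((b + r * (a + r) : ℝ) : ℂ) :=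
    IsAlgClosed.exists_pow_nat_eq _ (by norm_num)
  have hr0C : (r : ℂ) ^ 3 + a * (r : ℂ) ^ 2 + b * r + c = 0 := by exact_mod_cast hr0
  obtain ⟨t, ht, htre⟩ : ∃ t : ℂ,
      t ^ 2 = ((a + r : ℝ) : ℂ) ^ 2 - 4 * ((b + r * (a + r) : ℝ) : ℂ) ∧ 0 ≤ t.re := by
    rcases le_total 0 s.re with h0 | h0
    · exact ⟨s, hs, h0⟩
    · exact ⟨-s, by rw [neg_sq, hs], by simpa using h0⟩
  push_cast at ht
  refine ⟨((1 / 2 : ℝ) : ℂ) * (t - ((a + r : ℝ) : ℂ)), ?_, ?_⟩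
  · push_cast
    linear_combination hr0C + ((1 / 2 * (t - (a + r)) - r) / 4) * ht
  · rw [Complex.re_ofReal_mul, Complex.sub_re, Complex.ofReal_re]
    linarith

theorem fderiv_aux (κ₁ κ₂ κ₃ κ₄ x y z : ℝ) (w : Fin 3 → ℝ) :
    fderiv ℝ (massActionField κ₁ κ₂ κ₃ κ₄) ![x, y, z] w =
      ![w 0 * (κ₁ * z - κ₂ * y) + x * (κ₁ * w 2 - κ₂ * w 1),
        w 1 * (κ₂ * x - κ₃ * z) + y * (κ₂ * w 0 - κ₃ * w 2),
        w 2 * (-(κ₃ * y) - κ₁ * x) + z * (-(κ₃ * w 1) - κ₁ * w 0)] := by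
  have hp : ∀ i : Fin 3, HasFDerivAt (fun v : Fin 3 → ℝ => v i)
      (ContinuousLinearMap.proj (R := ℝ) (φ := fun _ : Fin 3 => ℝ) i) ![x, y, z] :=
    fun i => hasFDerivAt_apply i _
  have h0 := (hp 0).mul (((hp 2).const_mul κ₁).sub ((hp 1).const_mul κ₂))
  have h1 := (hp 1).mul (((hp 0).const_mul κ₂).sub ((hp 2).const_mul κ₃))
  have h2 := ((hp 2).mul ((((hp 1).const_mul κ₃).neg).sub ((hp 0).const_mul κ₁))).add_const (2 * κ₄)
  have hd : DifferentiableAt ℝ (massActionField κ₁ κ₂ κ₃ κ₄) ![x, y, z] := by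
    rw [differentiableAt_pi]
    intro i
    fin_cases i
    · exact h0.differentiableAt
    · exact h1.differentiableAt
    · exact h2.differentiableAt
  have hh := hasFDerivAt_pi'.1 hd.hasFDerivAt
  funext i
  fin_cases i
  · have := congrArg (fun L => L w) ((hh 0).unique h0)
    simp at this ⊢
    rw [this]; ring
  · have := congrArg (fun L => L w) ((hh 1).unique h1)
    simp at this ⊢
    rw [this]; ring
  · have := congrArg (fun L => L w) ((hh 2).unique h2)
    simp at this ⊢
    rw [this]; ring

/-- If κ₁ < κ₂ + κ₃, the polynomial λ³ + a₂λ² + a₁λ + a₀ (with a₂ = 2√(κ₁κ₃κ₄/κ₂),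
a₁ = (κ₁+κ₂−κ₃)κ₄, a₀ = 4√(κ₁κ₂κ₃κ₄³)) has a complex root with positive real part;
in particular, the Jacobian of system (2) at the positive equilibrium has an eigenvalue
with positive real part. -/
theorem root_pos_re_of_lt
    (κ₁ κ₂ κ₃ κ₄ : ℝ) (hκ₁ : 0 < κ₁) (hκ₂ : 0 < κ₂) (hκ₃ : 0 < κ₃) (hκ₄ : 0 < κ₄)
    (hlt : κ₁ < κ₂ + κ₃) :
    (∃ lam : ℂ,
      lam ^ 3 + (2 * Real.sqrt (κ₁ * κ₃ * κ₄ / κ₂) : ℝ) * lam ^ 2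
        + ((κ₁ + κ₂ - κ₃) * κ₄ : ℝ) * lam
        + (4 * Real.sqrt (κ₁ * κ₂ * κ₃ * κ₄ ^ 3) : ℝ) = 0 ∧ 0 < lam.re) ∧
    (∃ μ ∈ spectrum ℂ ((jacobianAtEq κ₁ κ₂ κ₃ κ₄).map (Complex.ofReal ·)), 0 < μ.re) := by
  
  set x := Real.sqrt (κ₃ * κ₄ / (κ₁ * κ₂)) with hx
  have hxpos : 0 < x := Real.sqrt_pos.2 (by positivity)
  have hx2 : x ^ 2 = κ₃ * κ₄ / (κ₁ * κ₂) := Real.sq_sqrt (by positivity)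
  have hx2' : κ₁ * κ₂ * x ^ 2 = κ₃ * κ₄ := by rw [hx2]; field_simp
  have hy : Real.sqrt (κ₁ * κ₄ / (κ₂ * κ₃)) = κ₁ * x / κ₃ := by
    rw [Real.sqrt_eq_iff_mul_self_eq_of_pos (by positivity)]
    field_simp
    linear_combination hx2'
  have hz : Real.sqrt (κ₂ * κ₄ / (κ₁ * κ₃)) = κ₂ * x / κ₃ := by
    rw [Real.sqrt_eq_iff_mul_self_eq_of_pos (by positivity)]
    field_simp
    linear_combination hx2'
  have h2 : Real.sqrt (κ₁ * κ₃ * κ₄ / κ₂) = κ₁ * x := by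
    rw [Real.sqrt_eq_iff_mul_self_eq_of_pos (by positivity)]
    field_simp
    linear_combination hx2'
  have h0 : Real.sqrt (κ₁ * κ₂ * κ₃ * κ₄ ^ 3) = κ₁ * κ₂ * κ₄ * x := by
    rw [Real.sqrt_eq_iff_mul_self_eq_of_pos (by positivity)]
    linear_combination κ₁ * κ₂ * κ₄ ^ 2 * hx2'
  rw [h2, h0]
  obtain ⟨lam, hl, hre⟩ := cubic_root_aux (2 * (κ₁ * x)) ((κ₁ + κ₂ - κ₃) * κ₄)
    (4 * (κ₁ * κ₂ * κ₄ * x)) (by positivity) (by positivity) (by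
      have : 0 < κ₁ * κ₄ * x := by positivity
      nlinarith [mul_pos this (sub_pos.2 hlt)])
  refine ⟨⟨lam, hl, hre⟩, lam, ?_, hre⟩
  have hJ : jacobianAtEq κ₁ κ₂ κ₃ κ₄ =
      !![0, -(κ₂ * x), κ₁ * x;
         κ₂ * (κ₁ * x / κ₃), 0, -(κ₁ * x);
         -(κ₁ * (κ₂ * x / κ₃)), -(κ₂ * x), -(2 * (κ₁ * x))] := by
    ext i j
    unfold jacobianAtEq
    rw [← hx, hy, hz, fderiv_aux]
    fin_cases i <;> fin_cases j <;> simp [Pi.single_apply] <;> field_simp <;> ring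
  rw [spectrum.mem_iff, Matrix.isUnit_iff_isUnit_det, isUnit_iff_ne_zero, not_not, hJ,
    Matrix.det_fin_three]
  have hk3 : (κ₃ : ℂ) ≠ 0 := by exact_mod_cast hκ₃.ne'
  have hxC : (κ₁ : ℂ) * κ₂ * x ^ 2 = κ₃ * κ₄ := by exact_mod_cast hx2'
  push_cast at hl
  simp [Matrix.algebraMap_matrix_apply]
  field_simp
  linear_combination (κ₃ : ℂ) * hl + (((κ₁ : ℂ) + κ₂ - κ₃) * lam + 4 * κ₁ * κ₂ * x) * hxC
end

section
/- (Theorem 1(i)) Let κ₁, κ₂, κ₃, κ₄ > 0 with κ₁ = κ₂ + κ₃, and define V(x,y,z) = (κ₂/2)(x − y + z)² + 2κ₂xy − 2κ₄ log(xy). Then V is a constant of motion for the mass-action system (2) on the region {x > 0, y > 0}: the directional derivative of V along the vector field of (2) vanishes identically, i.e., ∂V/∂x · x(κ₁z − κ₂y) + ∂V/∂y · y(κ₂x − κ₃z) + ∂V/∂z · (z(−κ₃y − κ₁x) + 2κ₄) = 0 for all x > 0, y > 0, z ∈ ℝ. Equivalently, for any differentiable solution t ↦ (x(t), y(t), z(t))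 of (2) with x(t) > 0, y(t) > 0, the function t ↦ V(x(t), y(t), z(t)) is constant. -/
/-- Theorem 1(i): for κ₁ = κ₂ + κ₃, the function
V(x,y,z) = (κ₂/2)(x−y+z)² + 2κ₂xy − 2κ₄ log(xy) is a constant of motion for the
mass-action system (2) on {x > 0, y > 0}: its directional derivative along the vector
field vanishes identically, and equivalently V is constant along every differentiable
solution with positive x and y components. -/
theorem V_constant_of_motion
    (κ₁ κ₂ κ₃ κ₄ : ℝ) (hκ₁ : 0 < κ₁) (hκ₂ : 0 < κ₂) (hκ₃ : 0 < κ₃) (hκ₄ : 0 < κ₄)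
    (heq : κ₁ = κ₂ + κ₃)
    (V : ℝ → ℝ → ℝ → ℝ)
    (hV : ∀ x y z, V x y z =
      κ₂ / 2 * (x - y + z) ^ 2 + 2 * κ₂ * x * y - 2 * κ₄ * Real.log (x * y)) :
    (∀ x y z : ℝ, 0 < x → 0 < y →
      deriv (fun x' => V x' y z) x * (x * (κ₁ * z - κ₂ * y))
        + deriv (fun y' => V x y' z) y * (y * (κ₂ * x - κ₃ * z))
        + deriv (fun z' => V x y z') z * (z * (-(κ₃ * y) - κ₁ * x) + 2 * κ₄) = 0) ∧
    (∀ x y z : ℝ → ℝ,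
      (∀ t : ℝ, HasDerivAt x (x t * (κ₁ * z t - κ₂ * y t)) t ∧
                HasDerivAt y (y t * (κ₂ * x t - κ₃ * z t)) t ∧
                HasDerivAt z (z t * (-(κ₃ * y t) - κ₁ * x t) + 2 * κ₄) t) →
      (∀ t : ℝ, 0 < x t ∧ 0 < y t) →
      ∀ s t : ℝ, V (x s) (y s) (z s) = V (x t) (y t) (z t)) := by
  have key : ∀ (x y z : ℝ → ℝ) (a b c t : ℝ), HasDerivAt x a t → HasDerivAt y b t →
      HasDerivAt z c t → 0 < x t → 0 < y t →
      HasDerivAt (fun t => V (x t) (y t) (z t))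
        (κ₂ * (x t - y t + z t) * (a - b + c) + 2 * κ₂ * (a * y t + x t * b)
          - 2 * κ₄ * ((a * y t + x t * b) / (x t * y t))) t := by
    intro x y z a b c t hx hy hz px py
    have h1 := (((hx.sub hy).add hz).pow 2).const_mul (κ₂ / 2)
    have h2 := (hx.mul hy).const_mul (2 * κ₂)
    have h3 := ((hx.mul hy).log (mul_pos px py).ne').const_mul (2 * κ₄)
    have h4 := (h1.add h2).sub h3
    refine (h4.congr_deriv ?_).congr_of_eventuallyEq (Filter.Eventually.of_forall ?_)
    · simp
      ring
    · intro u
      simp [hV]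
      ring
  refine ⟨?_, ?_⟩
  · intro x y z px py
    have e1 := (key (fun u => u) (fun _ => y) (fun _ => z) 1 0 0 x (hasDerivAt_id' x)
      (hasDerivAt_const _ _) (hasDerivAt_const _ _) px py).deriv
    have e2 := (key (fun _ => x) (fun u => u) (fun _ => z) 0 1 0 y (hasDerivAt_const _ _)
      (hasDerivAt_id' y) (hasDerivAt_const _ _) px py).deriv
    have e3 := (key (fun _ => x) (fun _ => y) (fun u => u) 0 0 1 z (hasDerivAt_const _ _)
      (hasDerivAt_const _ _) (hasDerivAt_id' z) px py).deriv
    rw [e1, e2, e3, heq]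
    field_simp
    ring
  · intro x y z h hp s t
    have hd : ∀ t, HasDerivAt (fun t => V (x t) (y t) (z t)) 0 t := by
      intro t
      obtain ⟨hx, hy, hz⟩ := h t
      obtain ⟨px, py⟩ := hp t
      refine (key x y z _ _ _ t hx hy hz px py).congr_deriv ?_
      rw [heq]
      field_simp
      ring
    exact is_const_of_deriv_eq_zero (fun t => (hd t).differentiableAt)
      (fun t => (hd t).deriv) s t
end

section
/- (Theorem 1(ii), convergence part) Let κ₁, κ₂, κ₃, κ₄ > 0 with κ₁ = κ₂ + κ₃, and let S = {(x,y,z) ∈ ℝ³ : x > 0, y > 0, x − y + z = 0, xy = κ₄/κ₂}. Then S is invariant for the mass-action system (2) (any solution starting in S remains in S), the positive equilibrium (x*, y*, z*) = (√(κ₃κ₄/(κ₁κ₂)), √(κ₁κ₄/(κ₂κ₃)), √(κ₂κ₄/(κ₁κ₃))) lies in S, and every solution of (2) with initial condition in S is defined for all t ≥ 0 and converges to (x*, y*, z*) as t → ∞. -/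
lemma gron_aux (f f' : ℝ → ℝ) (K T : ℝ) (hT : 0 ≤ T)
    (h : ∀ t ∈ Set.Icc (0 : ℝ) T, HasDerivAt f (f' t) t)
    (hb : ∀ t ∈ Set.Icc (0 : ℝ) T, f' t ≤ K * f t) : f T ≤ f 0 * Real.exp (K * T) := by
  have hd : ∀ t ∈ Set.Icc (0 : ℝ) T, HasDerivAt (fun t => f t * Real.exp (-(K * t)))
      (f' t * Real.exp (-(K * t)) + f t * (Real.exp (-(K * t)) * (-(K * 1)))) t := by
    intro t ht
    exact (h t ht).mul ((((hasDerivAt_id t).const_mul K).neg).exp)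
  have ha : AntitoneOn (fun t => f t * Real.exp (-(K * t))) (Set.Icc 0 T) := by
    apply antitoneOn_of_deriv_nonpos (convex_Icc 0 T)
    · exact fun t ht => (hd t ht).continuousAt.continuousWithinAt
    · intro t ht
      exact (hd t (interior_subset ht)).differentiableAt.differentiableWithinAt
    · intro t ht
      have ht' := interior_subset ht
      rw [(hd t ht').deriv]
      have := hb t ht'
      have he := Real.exp_pos (-(K * t))
      nlinarith
  have := ha (Set.left_mem_Icc.2 hT) (Set.right_mem_Icc.2 hT) hT
  simp only [mul_zero, neg_zero, Real.exp_zero, mul_one] at this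
  rw [Real.exp_neg, ← div_eq_mul_inv, div_le_iff₀ (Real.exp_pos _)] at this
  exact this

lemma inv_aux (κ₁ κ₂ κ₃ κ₄ : ℝ) (hκ₂ : 0 < κ₂) (hκ₄ : 0 < κ₄)
    (heq : κ₁ = κ₂ + κ₃) (x y z : ℝ → ℝ) (T : ℝ) (hT : 0 ≤ T)
    (h : ∀ t ∈ Set.Icc (0 : ℝ) T,
        HasDerivAt x (x t * (κ₁ * z t - κ₂ * y t)) t ∧
        HasDerivAt y (y t * (κ₂ * x t - κ₃ * z t)) t ∧
        HasDerivAt z (z t * (-(κ₃ * y t) - κ₁ * x t) + 2 * κ₄) t)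
    (hx0 : 0 < x 0) (hu0 : x 0 - y 0 + z 0 = 0) (hv0 : x 0 * y 0 = κ₄ / κ₂) :
    0 < x T ∧ 0 < y T ∧ x T - y T + z T = 0 ∧ x T * y T = κ₄ / κ₂ := by
  have hc : 0 < κ₄ / κ₂ := by positivity
  have hk : κ₄ = κ₂ * (κ₄ / κ₂) := by field_simp
  set c := κ₄ / κ₂ with hcdef
  have hxc : ContinuousOn x (Set.Icc 0 T) :=
    fun t ht => (h t ht).1.continuousAt.continuousWithinAt
  have hyc : ContinuousOn y (Set.Icc 0 T) :=
    fun t ht => (h t ht).2.1.continuousAt.continuousWithinAt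
  obtain ⟨M, hM⟩ := isCompact_Icc.exists_bound_of_continuousOn (hxc.mul hyc)
  have key : ∀ t ∈ Set.Icc (0 : ℝ) T, x t - y t + z t = 0 ∧ x t * y t = c := by
    intro t ht
    have hsub : ∀ s ∈ Set.Icc (0 : ℝ) t, s ∈ Set.Icc (0 : ℝ) T :=
      fun s hs => ⟨hs.1, hs.2.trans ht.2⟩
    have := gron_aux
      (fun s => (x s - y s + z s) ^ 2 + (x s * y s - c) ^ 2)
      (fun s => 2 * (x s - y s + z s) * (-2 * κ₂ * (x s * y s - c))
        + 2 * (x s * y s - c) * (κ₂ * (x s * y s) * (x s - y s + z s)))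
      (2 * κ₂ + κ₂ * M) t ht.1 ?_ ?_
    · simp only [hu0, hv0, sub_self] at this
      norm_num at this
      constructor <;> nlinarith [sq_nonneg (x t - y t + z t), sq_nonneg (x t * y t - c)]
    · intro s hs
      obtain ⟨h1, h2, h3⟩ := h s (hsub s hs)
      have hu := (((h1.sub h2).add h3).pow 2)
      have hv := (((h1.mul h2).sub_const c).pow 2)
      refine (hu.add hv).congr_deriv ?_
      simp only [Pi.add_apply, Pi.sub_apply, Pi.mul_apply]
      push_cast
      rw [heq]
      generalize x s = X at *
      generalize y s = Y at *
      generalize z s = Z at *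
      linear_combination 4 * (X - Y + Z) * hk
    · intro s hs
      have hm := hM s (hsub s hs)
      rw [Real.norm_eq_abs, abs_le] at hm
      simp only [Pi.mul_apply] at hm
      generalize x s - y s + z s = u at *
      generalize x s * y s = p at *
      have h1 : 0 ≤ κ₂ * (2 * (u + (p - c)) ^ 2) := by positivity
      have h2 : 0 ≤ κ₂ * ((M - p) * (u + (p - c)) ^ 2) :=
        mul_nonneg hκ₂.le (mul_nonneg (by linarith) (sq_nonneg _))
      have h3 : 0 ≤ κ₂ * ((M + p) * (u - (p - c)) ^ 2) :=
        mul_nonneg hκ₂.le (mul_nonneg (by linarith) (sq_nonneg _))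
      nlinarith [mul_nonneg hκ₂.le (sq_nonneg (u - (p-c)))]
  have hxT : 0 < x T := by
    by_contra hneg
    push Not at hneg
    obtain ⟨s, hs, hs0⟩ := intermediate_value_Icc' hT hxc (show (0:ℝ) ∈ Set.Icc (x T) (x 0) from ⟨hneg, hx0.le⟩)
    have := (key s hs).2
    rw [hs0] at this
    linarith
  obtain ⟨k1, k2⟩ := key T ⟨hT, le_rfl⟩
  exact ⟨hxT, by by_contra hn; push Not at hn; nlinarith, k1, k2⟩

lemma exist_aux (a b x0 : ℝ) (ha : 0 < a) (hb : 0 < b) (hx0 : 0 < x0) :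
    ∃ x : ℝ → ℝ, x 0 = x0 ∧ ∀ t ≥ (0:ℝ), 0 < x t ∧ HasDerivAt x (a - b * x t ^ 2) t := by
  set w := Real.sqrt (a * b) with hw
  have hwp : 0 < w := Real.sqrt_pos.2 (by positivity)
  have hw2 : w ^ 2 = a * b := Real.sq_sqrt (by positivity)
  refine ⟨fun t => (w * Real.sinh (w * t) + b * x0 * Real.cosh (w * t)) /
    (b * (Real.cosh (w * t) + b * x0 / w * Real.sinh (w * t))), ?_, ?_⟩
  · simp; field_simp
  · intro t ht
    have hsn : 0 ≤ Real.sinh (w * t) := Real.sinh_nonneg_iff.2 (by positivity)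
    have hcs := Real.cosh_pos (w * t)
    have hl : HasDerivAt (fun t => w * t) w t := by simpa using (hasDerivAt_id t).const_mul w
    have hN := (hl.sinh.const_mul w).add (hl.cosh.const_mul (b * x0))
    have hD := (hl.cosh.add (hl.sinh.const_mul (b * x0 / w))).const_mul b
    have hDp : 0 < b * (Real.cosh (w * t) + b * x0 / w * Real.sinh (w * t)) := by positivity
    refine ⟨by positivity, ?_⟩
    refine (hN.div hD hDp.ne').congr_deriv ?_
    simp only [Pi.add_apply]
    generalize Real.cosh (w * t) = C at *
    generalize Real.sinh (w * t) = s at *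
    have hE : 0 < w * C + b * x0 * s := by positivity
    have ha' : a = w ^ 2 / b := by field_simp; linarith
    rw [ha']
    field_simp

/-- Theorem 1(ii), convergence part: for κ₁ = κ₂ + κ₃ the set
S = {(x,y,z) : x > 0, y > 0, x − y + z = 0, xy = κ₄/κ₂} is invariant for the
mass-action system (2), contains the positive equilibrium, and every solution of (2)
with initial condition in S is defined for all t ≥ 0 and converges to the positive
equilibrium as t → ∞. -/
theorem stable_manifold_convergence
    (κ₁ κ₂ κ₃ κ₄ : ℝ) (hκ₁ : 0 < κ₁) (hκ₂ : 0 < κ₂) (hκ₃ : 0 < κ₃) (hκ₄ : 0 < κ₄)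
    (heq : κ₁ = κ₂ + κ₃)
    (S : Set (ℝ × ℝ × ℝ))
    (hS : S = {w : ℝ × ℝ × ℝ | 0 < w.1 ∧ 0 < w.2.1 ∧
      w.1 - w.2.1 + w.2.2 = 0 ∧ w.1 * w.2.1 = κ₄ / κ₂}) :
    -- the positive equilibrium lies in S
    (Real.sqrt (κ₃ * κ₄ / (κ₁ * κ₂)), Real.sqrt (κ₁ * κ₄ / (κ₂ * κ₃)),
      Real.sqrt (κ₂ * κ₄ / (κ₁ * κ₃))) ∈ S ∧
    -- S is invariant: any solution starting in S remains in S
    (∀ (x y z : ℝ → ℝ) (T : ℝ),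
      (∀ t ∈ Set.Icc (0 : ℝ) T,
        HasDerivAt x (x t * (κ₁ * z t - κ₂ * y t)) t ∧
        HasDerivAt y (y t * (κ₂ * x t - κ₃ * z t)) t ∧
        HasDerivAt z (z t * (-(κ₃ * y t) - κ₁ * x t) + 2 * κ₄) t) →
      (x 0, y 0, z 0) ∈ S → ∀ t ∈ Set.Icc (0 : ℝ) T, (x t, y t, z t) ∈ S) ∧
    -- every solution starting in S is defined for all t ≥ 0 ...
    (∀ w ∈ S, ∃ x y z : ℝ → ℝ, (x 0, y 0, z 0) = w ∧
      ∀ t ≥ (0 : ℝ),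
        HasDerivAt x (x t * (κ₁ * z t - κ₂ * y t)) t ∧
        HasDerivAt y (y t * (κ₂ * x t - κ₃ * z t)) t ∧
        HasDerivAt z (z t * (-(κ₃ * y t) - κ₁ * x t) + 2 * κ₄) t) ∧
    -- ... and converges to the positive equilibrium as t → ∞
    (∀ x y z : ℝ → ℝ,
      (∀ t ≥ (0 : ℝ),
        HasDerivAt x (x t * (κ₁ * z t - κ₂ * y t)) t ∧
        HasDerivAt y (y t * (κ₂ * x t - κ₃ * z t)) t ∧
        HasDerivAt z (z t * (-(κ₃ * y t) - κ₁ * x t) + 2 * κ₄) t) →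
      (x 0, y 0, z 0) ∈ S →
      Filter.Tendsto (fun t => (x t, y t, z t)) Filter.atTop
        (nhds (Real.sqrt (κ₃ * κ₄ / (κ₁ * κ₂)), Real.sqrt (κ₁ * κ₄ / (κ₂ * κ₃)),
          Real.sqrt (κ₂ * κ₄ / (κ₁ * κ₃))))) := by
  have hc : 0 < κ₄ / κ₂ := by positivity
  have hk : κ₄ = κ₂ * (κ₄ / κ₂) := by field_simp
  have hmem : 0 < Real.sqrt (κ₃ * κ₄ / (κ₁ * κ₂)) ∧ 0 < Real.sqrt (κ₁ * κ₄ / (κ₂ * κ₃)) ∧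
      Real.sqrt (κ₃ * κ₄ / (κ₁ * κ₂)) - Real.sqrt (κ₁ * κ₄ / (κ₂ * κ₃)) +
        Real.sqrt (κ₂ * κ₄ / (κ₁ * κ₃)) = 0 ∧
      Real.sqrt (κ₃ * κ₄ / (κ₁ * κ₂)) * Real.sqrt (κ₁ * κ₄ / (κ₂ * κ₃)) = κ₄ / κ₂ := by
    refine ⟨Real.sqrt_pos.2 (by positivity), Real.sqrt_pos.2 (by positivity), ?_, ?_⟩
    · have e1 : κ₃ * κ₄ / (κ₁ * κ₂) = κ₃ ^ 2 * (κ₄ / (κ₁ * κ₂ * κ₃)) := by field_simp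
      have e2 : κ₁ * κ₄ / (κ₂ * κ₃) = κ₁ ^ 2 * (κ₄ / (κ₁ * κ₂ * κ₃)) := by field_simp
      have e3 : κ₂ * κ₄ / (κ₁ * κ₃) = κ₂ ^ 2 * (κ₄ / (κ₁ * κ₂ * κ₃)) := by field_simp
      rw [e1, e2, e3, Real.sqrt_mul (by positivity), Real.sqrt_mul (by positivity),
        Real.sqrt_mul (by positivity), Real.sqrt_sq hκ₁.le, Real.sqrt_sq hκ₂.le,
        Real.sqrt_sq hκ₃.le]
      generalize Real.sqrt _ = r
      rw [heq]; ring
    · rw [← Real.sqrt_mul (by positivity)]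
      rw [show κ₃ * κ₄ / (κ₁ * κ₂) * (κ₁ * κ₄ / (κ₂ * κ₃)) = (κ₄ / κ₂) ^ 2 by field_simp]
      exact Real.sqrt_sq hc.le
  subst hS
  refine ⟨hmem, ?_, ?_, ?_⟩
  · intro x y z T h h0 t ht
    exact inv_aux κ₁ κ₂ κ₃ κ₄ hκ₂ hκ₄ heq x y z t ht.1
      (fun s hs => h s ⟨hs.1, hs.2.trans ht.2⟩) h0.1 h0.2.2.1 h0.2.2.2
  · rintro ⟨x0, y0, z0⟩ ⟨hx0, hy0, hu, hv⟩
    dsimp only at hx0 hy0 hu hv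
    obtain ⟨x, hx00, hx⟩ := exist_aux (κ₃ * (κ₄ / κ₂)) κ₁ x0 (by positivity) hκ₁ hx0
    have hy0' : κ₄ / κ₂ / x0 = y0 := by rw [← hv]; field_simp
    refine ⟨x, fun t => κ₄ / κ₂ / x t, fun t => κ₄ / κ₂ / x t - x t, ?_, ?_⟩
    · simp only [hx00, hy0', Prod.mk.injEq, true_and]
      linarith
    · intro t ht
      obtain ⟨hp, hd⟩ := hx t ht
      have hy := (hasDerivAt_const t (κ₄ / κ₂)).div hd hp.ne'
      refine ⟨hd.congr_deriv ?_, hy.congr_deriv ?_, (hy.sub hd).congr_deriv ?_⟩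
      all_goals
        dsimp only
        rw [heq]
        field_simp
        ring
  · intro x y z h h0
    have hS : ∀ t ≥ (0:ℝ), 0 < x t ∧ 0 < y t ∧ x t - y t + z t = 0 ∧ x t * y t = κ₄ / κ₂ :=
      fun t ht => inv_aux κ₁ κ₂ κ₃ κ₄ hκ₂ hκ₄ heq x y z t ht
        (fun s hs => h s hs.1) h0.1 h0.2.2.1 h0.2.2.2
    obtain ⟨m1, m2, m3, m4⟩ := hmem
    have hsq : κ₁ * Real.sqrt (κ₃ * κ₄ / (κ₁ * κ₂)) ^ 2 = κ₃ * (κ₄ / κ₂) := by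
      rw [Real.sq_sqrt (by positivity)]; field_simp
    generalize Real.sqrt (κ₃ * κ₄ / (κ₁ * κ₂)) = p at *
    generalize Real.sqrt (κ₁ * κ₄ / (κ₂ * κ₃)) = q at *
    generalize Real.sqrt (κ₂ * κ₄ / (κ₁ * κ₃)) = r at *
    have hbound : ∀ t ≥ (0:ℝ), (x t - p) ^ 2 ≤ (x 0 - p) ^ 2 * Real.exp (-(2 * κ₁ * p) * t) := by
      intro t ht
      refine gron_aux (fun s => (x s - p) ^ 2)
        (fun s => -2 * κ₁ * (x s + p) * (x s - p) ^ 2) (-(2 * κ₁ * p)) t ht ?_ ?_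
      · intro s hs
        obtain ⟨i1, i2, i3, i4⟩ := hS s hs.1
        refine (((h s hs.1).1.sub_const p).pow 2).congr_deriv ?_
        have hz : z s = y s - x s := by linarith
        rw [hz]
        push_cast
        linear_combination 2 * (x s - p) * (κ₃ * i4 - hsq) + 2 * (x s - p) * x s * y s * heq
      · intro s hs
        obtain ⟨i1, i2, i3, i4⟩ := hS s hs.1
        have : 0 ≤ κ₁ * x s * (x s - p) ^ 2 := by positivity
        try dsimp only
        nlinarith
    have hE : Filter.Tendsto (fun t => (x 0 - p) ^ 2 * Real.exp (-(2 * κ₁ * p) * t))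
        Filter.atTop (nhds 0) := by
      have : Filter.Tendsto (fun t : ℝ => -(2 * κ₁ * p) * t) Filter.atTop Filter.atBot :=
        Filter.tendsto_id.const_mul_atTop_of_neg (by have : 0 < 2 * κ₁ * p := by positivity
                                                     linarith)
      simpa using (Real.tendsto_exp_atBot.comp this).const_mul ((x 0 - p) ^ 2)
    have hsq0 : Filter.Tendsto (fun t => (x t - p) ^ 2) Filter.atTop (nhds 0) :=
      tendsto_of_tendsto_of_tendsto_of_le_of_le' tendsto_const_nhds hE
        (Filter.Eventually.of_forall fun t => sq_nonneg _)
        ((Filter.eventually_ge_atTop 0).mono hbound)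
    have hx : Filter.Tendsto x Filter.atTop (nhds p) := by
      have h1 := (Real.continuous_sqrt.tendsto 0).comp hsq0
      simp only [Function.comp_def, Real.sqrt_sq_eq_abs, Real.sqrt_zero] at h1
      have h2 := ((tendsto_zero_iff_abs_tendsto_zero _).2 h1).add_const p
      simpa using h2
    have hy : Filter.Tendsto y Filter.atTop (nhds q) := by
      have h1 := (tendsto_const_nhds (x := κ₄ / κ₂)).div hx m1.ne'
      rw [show κ₄ / κ₂ / p = q by rw [← m4]; field_simp] at h1
      refine h1.congr' ((Filter.eventually_ge_atTop 0).mono fun t ht => ?_)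
      obtain ⟨i1, i2, i3, i4⟩ := hS t ht
      dsimp only [Pi.div_apply]
      rw [← i4]; field_simp
    have hz : Filter.Tendsto z Filter.atTop (nhds r) := by
      have h1 := hy.sub hx
      rw [show q - p = r by linarith] at h1
      refine h1.congr' ((Filter.eventually_ge_atTop 0).mono fun t ht => ?_)
      obtain ⟨i1, i2, i3, i4⟩ := hS t ht
      try dsimp only
      linarith
    exact hx.prodMk_nhds (hy.prodMk_nhds hz)
end

section
/- Let κ₁, κ₂, κ₃, κ₄ > 0 with κ₁ = κ₂ + κ₃, and let α = √(κ₁κ₃κ₄/κ₂). If t ↦ (x(t), y(t), z(t)) is a differentiable solution of the mass-action system (2) with x(t) > 0 and y(t) > 0 for all t in an interval, then the functions p = x − y + z, q = log x + log y − log(κ₄/κ₂), r = −log x + log √(κ₃κ₄/(κ₁κ₂)) satisfy the transformed system (8): ṗ = −2κ₄(e^q − 1), q̇ = κ₂p, ṙ = −κ₁p + α(e^{−r} − e^{q+r}). -/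
/-- If t ↦ (x(t), y(t), z(t)) is a differentiable solution of the mass-action system (2)
with κ₁ = κ₂ + κ₃ and x, y > 0 on an interval, then p = x − y + z,
q = log x + log y − log(κ₄/κ₂), r = −log x + log √(κ₃κ₄/(κ₁κ₂)) satisfy the transformed
system (8): ṗ = −2κ₄(e^q − 1), q̇ = κ₂p, ṙ = −κ₁p + α(e^{−r} − e^{q+r}), α = √(κ₁κ₃κ₄/κ₂). -/
theorem transformed_system
    (κ₁ κ₂ κ₃ κ₄ : ℝ) (hκ₁ : 0 < κ₁) (hκ₂ : 0 < κ₂) (hκ₃ : 0 < κ₃) (hκ₄ : 0 < κ₄)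
    (heq : κ₁ = κ₂ + κ₃)
    (α : ℝ) (hα : α = Real.sqrt (κ₁ * κ₃ * κ₄ / κ₂))
    (I : Set ℝ) (hI : I.OrdConnected)  -- I is an interval
    (x y z : ℝ → ℝ)
    (hode : ∀ t ∈ I,
      HasDerivAt x (x t * (κ₁ * z t - κ₂ * y t)) t ∧
      HasDerivAt y (y t * (κ₂ * x t - κ₃ * z t)) t ∧
      HasDerivAt z (z t * (-(κ₃ * y t) - κ₁ * x t) + 2 * κ₄) t)
    (hpos : ∀ t ∈ I, 0 < x t ∧ 0 < y t)
    (p q r : ℝ → ℝ)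
    (hp : ∀ t, p t = x t - y t + z t)
    (hq : ∀ t, q t = Real.log (x t) + Real.log (y t) - Real.log (κ₄ / κ₂))
    (hr : ∀ t, r t = -Real.log (x t) + Real.log (Real.sqrt (κ₃ * κ₄ / (κ₁ * κ₂)))) :
    ∀ t ∈ I,
      HasDerivAt p (-(2 * κ₄) * (Real.exp (q t) - 1)) t ∧
      HasDerivAt q (κ₂ * p t) t ∧
      HasDerivAt r (-(κ₁ * p t) + α * (Real.exp (-r t) - Real.exp (q t + r t))) t := by
  intro t ht
  obtain ⟨hx, hy, hz⟩ := hode t ht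
  obtain ⟨px, py⟩ := hpos t ht
  have hpf : p = fun t => x t - y t + z t := funext hp
  have hqf : q = fun t => Real.log (x t) + Real.log (y t) - Real.log (κ₄ / κ₂) := funext hq
  have hrf : r = fun t => -Real.log (x t) + Real.log (Real.sqrt (κ₃ * κ₄ / (κ₁ * κ₂))) :=
    funext hr
  obtain ⟨s, hs⟩ : ∃ s, s = Real.sqrt (κ₃ * κ₄ / (κ₁ * κ₂)) := ⟨_, rfl⟩
  have spos : 0 < s := by rw [hs]; positivity
  have s2 : s ^ 2 = κ₃ * κ₄ / (κ₁ * κ₂) := by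
    rw [hs]; exact Real.sq_sqrt (by positivity)
  have hαs : α = κ₁ * s := by
    rw [hα, show κ₁ * κ₃ * κ₄ / κ₂ = (κ₁ * s) ^ 2 by rw [mul_pow, s2]; field_simp]
    exact Real.sqrt_sq (by positivity)
  have e1 : Real.exp (q t) = x t * y t / (κ₄ / κ₂) := by
    rw [hq, Real.exp_sub, Real.exp_add, Real.exp_log px, Real.exp_log py,
      Real.exp_log (by positivity)]
  have e2 : Real.exp (r t) = s / x t := by
    rw [hr, ← hs, Real.exp_add, Real.exp_neg, Real.exp_log px, Real.exp_log spos]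
    field_simp
  refine ⟨?_, ?_, ?_⟩
  · rw [e1, hpf]
    refine ((hx.sub hy).add hz).congr_deriv ?_
    field_simp
    ring
  · rw [hp, hqf]
    refine (((hx.log px.ne').add (hy.log py.ne')).sub_const _).congr_deriv ?_
    field_simp
    rw [heq]
    ring
  · rw [Real.exp_neg, Real.exp_add, e1, e2, hp, hαs, hrf]
    refine ((hx.log px.ne').neg.add_const _).congr_deriv ?_
    have h3 : κ₁ * s * (x t * y t / (κ₄ / κ₂) * (s / x t)) = κ₃ * y t := by
      have : κ₁ * s * (x t * y t / (κ₄ / κ₂) * (s / x t)) = s ^ 2 * (κ₁ * κ₂ / κ₄ * y t) := by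
        field_simp
      rw [this, s2]; field_simp
    have h4 : κ₁ * s * (s / x t)⁻¹ = κ₁ * x t := by field_simp
    have h5 : x t * (κ₁ * z t - κ₂ * y t) / x t = κ₁ * z t - κ₂ * y t := by field_simp
    rw [h5, mul_sub (κ₁ * s), h3, h4, heq]
    ring
end

section
/- Let κ₁, κ₂, κ₃, κ₄ > 0 with κ₁ = κ₂ + κ₃, let α = √(κ₁κ₃κ₄/κ₂), and let H(p, q) = (κ₂/2)p² + 2κ₄(e^q − q − 1). For every L > 0 there exist real numbers r̲ < 0 < r̅ such that for all (p, q) ∈ ℝ² with H(p, q) = L: if r > r̅ then −κ₁p + α(e^{−r} − e^{q+r}) < 0, and if r < r̲ then −κ₁p + α(e^{−r} − e^{q+r}) > 0. Consequently, the bounded cylinder {(p,q,r) : H(p,q) = L, r̲ ≤ r ≤ r̅} is forward invariant for the transformed system (8). -/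
/-- On every cylinder {H(p,q) = L} (L > 0) there are r̲ < 0 < r̅ such that the third
component ṙ = −κ₁p + α(e^{−r} − e^{q+r}) of the transformed system (8) is negative for
r > r̅ and positive for r < r̲; consequently the bounded cylinder
{(p,q,r) : H(p,q) = L, r̲ ≤ r ≤ r̅} is forward invariant for system (8). -/
theorem bounded_cylinder_forward_invariant
    (κ₁ κ₂ κ₃ κ₄ : ℝ) (hκ₁ : 0 < κ₁) (hκ₂ : 0 < κ₂) (hκ₃ : 0 < κ₃) (hκ₄ : 0 < κ₄)
    (heq : κ₁ = κ₂ + κ₃)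
    (α : ℝ) (hα : α = Real.sqrt (κ₁ * κ₃ * κ₄ / κ₂))
    (H : ℝ → ℝ → ℝ)
    (hH : ∀ p q, H p q = κ₂ / 2 * p ^ 2 + 2 * κ₄ * (Real.exp q - q - 1))
    (L : ℝ) (hL : 0 < L) :
    ∃ rlo rhi : ℝ, rlo < 0 ∧ 0 < rhi ∧
      (∀ p q r : ℝ, H p q = L →
        (rhi < r → -(κ₁ * p) + α * (Real.exp (-r) - Real.exp (q + r)) < 0) ∧
        (r < rlo → 0 < -(κ₁ * p) + α * (Real.exp (-r) - Real.exp (q + r)))) ∧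
      (∀ p q r : ℝ → ℝ,
        (∀ t ≥ (0 : ℝ),
          HasDerivAt p (-(2 * κ₄) * (Real.exp (q t) - 1)) t ∧
          HasDerivAt q (κ₂ * p t) t ∧
          HasDerivAt r (-(κ₁ * p t) + α * (Real.exp (-r t) - Real.exp (q t + r t))) t) →
        H (p 0) (q 0) = L → rlo ≤ r 0 → r 0 ≤ rhi →
        ∀ t ≥ (0 : ℝ), H (p t) (q t) = L ∧ rlo ≤ r t ∧ r t ≤ rhi) := by
  have hα0 : 0 < α := by rw [hα]; positivity
  obtain ⟨M, hM⟩ : ∃ M, M = 2 * L / κ₂ := ⟨_, rfl⟩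
  obtain ⟨N, hN⟩ : ∃ N, N = L / (2 * κ₄) := ⟨_, rfl⟩
  have hM0 : 0 < M := by rw [hM]; positivity
  have hN0 : 0 < N := by rw [hN]; positivity
  obtain ⟨K, hK⟩ : ∃ K, K = κ₁ * (M + 1) / α := ⟨_, rfl⟩
  have hK0 : 0 < K := by rw [hK]; positivity
  have hKα : α * K = κ₁ * (M + 1) := by rw [hK]; field_simp
  have hMκ : κ₂ * M = 2 * L := by rw [hM]; field_simp
  have hNκ : 2 * κ₄ * N = L := by rw [hN]; field_simp
  have bounds : ∀ p q : ℝ, H p q = L → p < M + 1 ∧ -(M + 1) < p ∧ -(2 * N + 1) ≤ q ∧ q ≤ 2 * N + 1 := by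
    intro p q h
    rw [hH] at h
    have h1 : 0 ≤ Real.exp q - q - 1 := by linarith [Real.add_one_le_exp q]
    have h2 : p ^ 2 ≤ M := by
      have : κ₂ * p ^ 2 ≤ κ₂ * M := by
        have := mul_nonneg (by positivity : 0 ≤ 2 * κ₄) h1
        linarith
      exact le_of_mul_le_mul_left this hκ₂
    have h3 : Real.exp q - q - 1 ≤ N := by
      have : 2 * κ₄ * (Real.exp q - q - 1) ≤ 2 * κ₄ * N := by
        have : 0 ≤ κ₂ / 2 * p ^ 2 := by positivity
        linarith
      exact le_of_mul_le_mul_left this (by positivity)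
    refine ⟨by nlinarith, by nlinarith, by linarith [Real.exp_pos q], ?_⟩
    rcases le_total q 0 with hq | hq
    · linarith
    · have := Real.quadratic_le_exp_of_nonneg hq
      nlinarith
  have up : ∀ p q r : ℝ, H p q = L → 2 * N + 1 + K ≤ r →
      -(κ₁ * p) + α * (Real.exp (-r) - Real.exp (q + r)) < 0 := by
    intro p q r h hr
    obtain ⟨h1, h2, h3, h4⟩ := bounds p q h
    have e1 : Real.exp (-r) ≤ 1 := Real.exp_le_one_iff.2 (by linarith)
    have e2 := Real.add_one_le_exp (q + r)
    have e3 : α * (Real.exp (-r) - Real.exp (q + r)) ≤ α * (-K) :=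
      mul_le_mul_of_nonneg_left (by linarith) hα0.le
    have e4 : κ₁ * (-(M + 1)) < κ₁ * p := mul_lt_mul_of_pos_left h2 hκ₁
    linarith
  have lo : ∀ p q r : ℝ, H p q = L → r ≤ -(2 * N + 1 + K) →
      0 < -(κ₁ * p) + α * (Real.exp (-r) - Real.exp (q + r)) := by
    intro p q r h hr
    obtain ⟨h1, h2, h3, h4⟩ := bounds p q h
    have e1 : Real.exp (q + r) ≤ 1 := Real.exp_le_one_iff.2 (by linarith)
    have e2 := Real.add_one_le_exp (-r)
    have e3 : α * K ≤ α * (Real.exp (-r) - Real.exp (q + r)) :=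
      mul_le_mul_of_nonneg_left (by linarith) hα0.le
    have e4 : κ₁ * p < κ₁ * (M + 1) := mul_lt_mul_of_pos_left h1 hκ₁
    linarith
  refine ⟨-(2 * N + 1 + K), 2 * N + 1 + K, by linarith, by linarith,
    fun p q r h => ⟨fun hr => up p q r h hr.le, fun hr => lo p q r h hr.le⟩, ?_⟩
  intro p q r hd h0 hr1 hr2
  have hHt : ∀ t ≥ (0 : ℝ), H (p t) (q t) = L := by
    intro t ht
    have key : ∀ s ≥ (0 : ℝ), HasDerivAt (fun s => H (p s) (q s)) 0 s := by
      intro s hs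
      obtain ⟨hp, hq, -⟩ := hd s hs
      simp only [hH]
      have := ((hp.pow 2).const_mul (κ₂ / 2)).add
        (((hq.exp.sub hq).sub_const 1).const_mul (2 * κ₄))
      refine this.congr_deriv ?_
      simp
      ring
    have := constant_of_has_deriv_right_zero (f := fun s => H (p s) (q s)) (a := 0) (b := t)
      (fun s hs => (key s hs.1).continuousAt.continuousWithinAt)
      (fun s hs => (key s hs.1).hasDerivWithinAt) t ⟨ht, le_rfl⟩
    exact this.trans h0
  intro t ht
  refine ⟨hHt t ht, ?_, ?_⟩
  · have := image_le_of_deriv_right_lt_deriv_boundary (f := fun s => -r s) (a := 0) (b := t)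
      (B := fun _ => 2 * N + 1 + K) (B' := fun _ => 0)
      (fun s hs => (hd s hs.1).2.2.neg.continuousAt.continuousWithinAt)
      (fun s hs => (hd s hs.1).2.2.neg.hasDerivWithinAt) (by linarith)
      (fun s => hasDerivAt_const _ _)
      (fun s hs he => by
        have := lo (p s) (q s) (r s) (hHt s hs.1) (by linarith)
        linarith) (x := t) ⟨ht, le_rfl⟩
    linarith
  · exact image_le_of_deriv_right_lt_deriv_boundary (f := r) (a := 0) (b := t)
      (B := fun _ => 2 * N + 1 + K) (B' := fun _ => 0)
      (fun s hs => (hd s hs.1).2.2.continuousAt.continuousWithinAt)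
      (fun s hs => (hd s hs.1).2.2.hasDerivWithinAt) hr2
      (fun s => hasDerivAt_const _ _)
      (fun s hs he => up (p s) (q s) (r s) (hHt s hs.1) he.ge) (x := t) ⟨ht, le_rfl⟩
end

section
/- Let κ₁, κ₂, κ₃, κ₄ > 0 with κ₁ = κ₂ + κ₃ and α = √(κ₁κ₃κ₄/κ₂). Fix L > 0, let q̄ < 0 be the unique negative solution of 2κ₄(e^q − q − 1) = L, and set K = 2αe^{q̄/2}. Suppose (p(t), q(t), r₁(t)) and (p(t), q(t), r₂(t)) are two solutions of the transformed system (8) defined for t ≥ 0 with the same (p, q)-components, with H(p(0), q(0)) = L and r₁(0) < r₂(0). Then for all t ≥ 0, 0 < r₂(t) − r₁(t) ≤ e^{−Kt}(r₂(0) − r₁(0)). -/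
theorem aux_mono (f f' : ℝ → ℝ) (T : ℝ) (hT : 0 ≤ T)
    (h : ∀ t ∈ Set.Icc 0 T, HasDerivAt f (f' t) t) (h0 : ∀ t ∈ Set.Icc 0 T, 0 ≤ f' t) :
    f 0 ≤ f T := by
  have hm : MonotoneOn f (Set.Icc 0 T) := by
    apply monotoneOn_of_deriv_nonneg (convex_Icc 0 T)
    · exact fun t ht => (h t ht).continuousAt.continuousWithinAt
    · intro t ht
      exact (h t (interior_subset ht)).differentiableAt.differentiableWithinAt
    · intro t ht
      rw [(h t (interior_subset ht)).deriv]
      exact h0 t (interior_subset ht)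
  exact hm ⟨le_refl _, hT⟩ ⟨hT, le_refl _⟩ hT

theorem aux_ineq (a b q qb : ℝ) (hab : a < b) (hq : qb ≤ q) :
    2 * Real.exp (qb / 2) * (b - a) ≤
      (Real.exp (-a) - Real.exp (-b)) + (Real.exp (q + b) - Real.exp (q + a)) := by
  obtain ⟨m, hm⟩ : ∃ m, m = (a + b) / 2 := ⟨_, rfl⟩
  obtain ⟨s, hs⟩ : ∃ s, s = (b - a) / 2 := ⟨_, rfl⟩
  have hs0 : 0 < s := by linarith
  have ha : a = m - s := by linarith
  have hb : b = m + s := by linarith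
  have hsinh : s ≤ Real.sinh s := Real.self_le_sinh_iff.mpr hs0.le
  rw [Real.sinh_eq] at hsinh
  have h1 : (Real.exp (-a) - Real.exp (-b)) + (Real.exp (q + b) - Real.exp (q + a)) =
      (Real.exp s - Real.exp (-s)) * (Real.exp (-m) + Real.exp (q + m)) := by
    rw [sub_mul, mul_add, mul_add]
    simp only [← Real.exp_add]
    rw [ha, hb]; ring_nf
  have h2 : 2 * Real.exp (q / 2) ≤ Real.exp (-m) + Real.exp (q + m) := by
    have e1 : Real.exp (-m) = Real.exp (-m / 2) ^ 2 := by
      rw [← Real.exp_nat_mul]; congr 1; push_cast; ring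
    have e2 : Real.exp (q + m) = Real.exp ((q + m) / 2) ^ 2 := by
      rw [← Real.exp_nat_mul]; congr 1; push_cast; ring
    have e3 : Real.exp (q / 2) = Real.exp (-m / 2) * Real.exp ((q + m) / 2) := by
      rw [← Real.exp_add]; congr 1; ring
    rw [e1, e2, e3]
    nlinarith [sq_nonneg (Real.exp (-m / 2) - Real.exp ((q + m) / 2))]
  have h3 : Real.exp (qb / 2) ≤ Real.exp (q / 2) := Real.exp_le_exp.mpr (by linarith)
  rw [h1]
  calc 2 * Real.exp (qb / 2) * (b - a) = (2 * s) * (2 * Real.exp (qb / 2)) := by rw [ha, hb]; ring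
    _ ≤ (Real.exp s - Real.exp (-s)) * (Real.exp (-m) + Real.exp (q + m)) := by
      apply mul_le_mul <;> first | linarith | positivity

/-- Contraction in the r-direction on the cylinder {H(p,q) = L}: two solutions of the
transformed system (8) lying above each other (same (p,q)-components) approach each
other exponentially with rate K = 2αe^{q̄/2}, where q̄ is the negative solution of
2κ₄(e^q − q − 1) = L. -/
theorem r_contraction
    (κ₁ κ₂ κ₃ κ₄ : ℝ) (hκ₁ : 0 < κ₁) (hκ₂ : 0 < κ₂) (hκ₃ : 0 < κ₃) (hκ₄ : 0 < κ₄)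
    (heq : κ₁ = κ₂ + κ₃)
    (α : ℝ) (hα : α = Real.sqrt (κ₁ * κ₃ * κ₄ / κ₂))
    (L : ℝ) (hL : 0 < L)
    (qbar : ℝ) (hqbar : qbar < 0) (hqbarL : 2 * κ₄ * (Real.exp qbar - qbar - 1) = L)
    (K : ℝ) (hK : K = 2 * α * Real.exp (qbar / 2))
    (p q r₁ r₂ : ℝ → ℝ)
    (hpq : ∀ t ≥ (0 : ℝ),
      HasDerivAt p (-(2 * κ₄) * (Real.exp (q t) - 1)) t ∧
      HasDerivAt q (κ₂ * p t) t)
    (hr₁ : ∀ t ≥ (0 : ℝ),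
      HasDerivAt r₁ (-(κ₁ * p t) + α * (Real.exp (-r₁ t) - Real.exp (q t + r₁ t))) t)
    (hr₂ : ∀ t ≥ (0 : ℝ),
      HasDerivAt r₂ (-(κ₁ * p t) + α * (Real.exp (-r₂ t) - Real.exp (q t + r₂ t))) t)
    (hH0 : κ₂ / 2 * (p 0) ^ 2 + 2 * κ₄ * (Real.exp (q 0) - q 0 - 1) = L)
    (hinit : r₁ 0 < r₂ 0) :
    ∀ t ≥ (0 : ℝ),
      0 < r₂ t - r₁ t ∧ r₂ t - r₁ t ≤ Real.exp (-(K * t)) * (r₂ 0 - r₁ 0) := by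
  have hα0 : 0 ≤ α := by rw [hα]; exact Real.sqrt_nonneg _
  -- conservation of H
  have hq : ∀ t ≥ (0 : ℝ), qbar ≤ q t := by
    intro T hT
    have hd : ∀ t ∈ Set.Icc 0 T, HasDerivAt
        (fun t => -(κ₂ / 2 * (p t) ^ 2 + 2 * κ₄ * (Real.exp (q t) - q t - 1))) 0 t := by
      intro t ht
      obtain ⟨h1, h2⟩ := hpq t ht.1
      have h := (((h1.pow 2).const_mul (κ₂ / 2)).add
        (((h2.exp.sub h2).sub_const 1).const_mul (2 * κ₄))).neg
      refine HasDerivAt.congr_deriv (f := _) h ?_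
      push_cast
      ring
    have hc := aux_mono _ (fun _ => 0) T hT hd (fun _ _ => le_refl _)
    beta_reduce at hc
    by_contra hlt
    push Not at hlt
    have hp2 : 0 ≤ κ₂ / 2 * (p T) ^ 2 := by positivity
    have h5 : 2 * κ₄ * (Real.exp (q T) - q T - 1) ≤ 2 * κ₄ * (Real.exp qbar - qbar - 1) := by
      linarith
    have h6 := le_of_mul_le_mul_left h5 (by positivity)
    have h7 : Real.exp (q T) = Real.exp qbar * Real.exp (q T - qbar) := by
      rw [← Real.exp_add]; congr 1; ring
    have h8 := Real.add_one_le_exp (q T - qbar)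
    have h9 : Real.exp qbar < 1 := Real.exp_lt_one_iff.mpr hqbar
    have h10 := mul_le_mul_of_nonneg_left h8 (Real.exp_pos qbar).le
    nlinarith
  -- the difference never vanishes
  have hne : ∀ t ≥ (0 : ℝ), r₂ t - r₁ t ≠ 0 := by
    intro T hT h0
    have hcont : ContinuousOn (fun t => -(κ₁ * p t) -
        α * Real.exp (q t) * (Real.exp (r₁ t) + Real.exp (r₂ t))) (Set.Icc 0 T) := by
      have cp : ContinuousOn p (Set.Icc 0 T) :=
        fun t ht => (hpq t ht.1).1.continuousAt.continuousWithinAt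
      have cq : ContinuousOn q (Set.Icc 0 T) :=
        fun t ht => (hpq t ht.1).2.continuousAt.continuousWithinAt
      have c1 : ContinuousOn r₁ (Set.Icc 0 T) :=
        fun t ht => (hr₁ t ht.1).continuousAt.continuousWithinAt
      have c2 : ContinuousOn r₂ (Set.Icc 0 T) :=
        fun t ht => (hr₂ t ht.1).continuousAt.continuousWithinAt
      fun_prop
    obtain ⟨M, hM⟩ := isCompact_Icc.exists_bound_of_continuousOn hcont
    have hd : ∀ t ∈ Set.Icc 0 T, HasDerivAt
        (fun t => (Real.exp (r₂ t) - Real.exp (r₁ t)) ^ 2 * Real.exp (2 * M * t))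
        (2 * ((-(κ₁ * p t) - α * Real.exp (q t) * (Real.exp (r₁ t) + Real.exp (r₂ t))) + M) *
          ((Real.exp (r₂ t) - Real.exp (r₁ t)) ^ 2 * Real.exp (2 * M * t))) t := by
      intro t ht
      have h := (((hr₂ t ht.1).exp.sub (hr₁ t ht.1).exp).pow 2).mul
        (((hasDerivAt_id t).const_mul (2 * M)).exp)
      refine HasDerivAt.congr_deriv (f := _) h ?_
      simp only [Real.exp_add, Real.exp_neg, Pi.sub_apply, Pi.pow_apply, id]
      have := (Real.exp_pos (r₁ t)).ne'
      have := (Real.exp_pos (r₂ t)).ne'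
      field_simp
      push_cast
      ring
    have hc := aux_mono _ _ T hT hd (by
      intro t ht
      have := hM t ht
      rw [Real.norm_eq_abs] at this
      have := (abs_le.mp this).1
      apply mul_nonneg
      · linarith
      · positivity)
    have hT2 : r₂ T = r₁ T := by linarith
    simp only [hT2, sub_self, mul_zero, Real.exp_zero, mul_one] at hc
    have := Real.exp_lt_exp.mpr hinit
    nlinarith
  have hpos : ∀ t ≥ (0 : ℝ), 0 < r₂ t - r₁ t := by
    intro T hT
    by_contra hle
    push Not at hle
    have cd : ContinuousOn (fun t => r₂ t - r₁ t) (Set.Icc 0 T) := fun t ht =>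
      ((hr₂ t ht.1).continuousAt.sub (hr₁ t ht.1).continuousAt).continuousWithinAt
    obtain ⟨t, ht, h0⟩ := intermediate_value_Icc' hT cd ⟨hle, (by linarith : 0 ≤ r₂ 0 - r₁ 0)⟩
    exact hne t ht.1 h0
  intro T hT
  refine ⟨hpos T hT, ?_⟩
  have hd : ∀ t ∈ Set.Icc 0 T, HasDerivAt (fun t => -((r₂ t - r₁ t) * Real.exp (K * t)))
      (Real.exp (K * t) * (α * ((Real.exp (-r₁ t) - Real.exp (-r₂ t)) +
        (Real.exp (q t + r₂ t) - Real.exp (q t + r₁ t))) - K * (r₂ t - r₁ t))) t := by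
    intro t ht
    have h := (((hr₂ t ht.1).sub (hr₁ t ht.1)).mul
      (((hasDerivAt_id t).const_mul K).exp)).neg
    refine HasDerivAt.congr_deriv (f := _) h ?_
    simp only [Pi.sub_apply, id]
    ring
  have hc := aux_mono _ _ T hT hd (by
    intro t ht
    apply mul_nonneg (Real.exp_pos _).le
    have h1 := aux_ineq (r₁ t) (r₂ t) (q t) qbar (by linarith [hpos t ht.1]) (hq t ht.1)
    have h2 := mul_le_mul_of_nonneg_left h1 hα0
    rw [hK]
    linarith)
  simp only [mul_zero, Real.exp_zero, mul_one] at hc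
  have h1 : (r₂ T - r₁ T) * Real.exp (K * T) ≤ r₂ 0 - r₁ 0 := by linarith
  rw [Real.exp_neg, inv_mul_eq_div, le_div_iff₀ (Real.exp_pos _)]
  exact h1
end

section
/- Let κ₁, κ₂, κ₃, κ₄ > 0 with κ₁ = κ₂ + κ₃ and α = √(κ₁κ₃κ₄/κ₂). For every q₀ > 0 there exists a unique r₀ ∈ ℝ such that the solution of the transformed system (8) with initial condition (0, q₀, r₀) is periodic: it is defined for all t ∈ ℝ and there exists T > 0 with (p(t+T), q(t+T), r(t+T)) = (p(t), q(t), r(t)) for all t. -/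
open Set Filter Topology

theorem upl_global {E : Type*} [NormedAddCommGroup E] [NormedSpace ℝ E] [CompleteSpace E]
    (v : ℝ → E → E) (K L : NNReal) (hK : ∀ t, LipschitzWith K (v t))
    (hc : ∀ x, Continuous (fun t => v t x)) (hL : ∀ t x, ‖v t x‖ ≤ L) (x₀ : E) :
    ∃ γ : ℝ → E, γ 0 = x₀ ∧ ∀ t, HasDerivAt γ (v t (γ t)) t := by
  have key : ∀ n : ℕ, ∃ β : ℝ → E, β 0 = x₀ ∧
      ∀ t ∈ Ioo (-((n:ℝ)+1)) ((n:ℝ)+1), HasDerivAt β (v t (β t)) t := by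
    intro n
    have h0 : (0:ℝ) ∈ Icc (-((n:ℝ)+1)) ((n:ℝ)+1) := by
      constructor <;> have := n.cast_nonneg (α := ℝ) <;> linarith
    have hp : IsPicardLindelof v (⟨0, h0⟩ : Icc (-((n:ℝ)+1)) ((n:ℝ)+1)) x₀
        (L * ((n:NNReal)+1)) 0 L K :=
      { lipschitzOnWith := fun t _ => (hK t).lipschitzOnWith
        continuousOn := fun x _ => (hc x).continuousOn
        norm_le := fun t _ x _ => hL t x
        mul_max_le := by simp }
    obtain ⟨β, h1, h2⟩ := hp.exists_eq_forall_mem_Icc_hasDerivWithinAt₀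
    exact ⟨β, h1, fun t ht => (h2 t (Ioo_subset_Icc_self ht)).hasDerivAt (Icc_mem_nhds ht.1 ht.2)⟩
  choose β hβ0 hβ using key
  have agree : ∀ n N : ℕ, n ≤ N → ∀ t ∈ Ioo (-((n:ℝ)+1)) ((n:ℝ)+1), β n t = β N t := by
    intro n N hnN t ht
    have hnN' : (n:ℝ) ≤ N := by exact_mod_cast hnN
    have hn0 := n.cast_nonneg (α := ℝ)
    refine ODE_solution_unique_of_mem_Ioo (v := v) (s := fun _ => univ) (K := K) (t₀ := 0)
      (a := -((n:ℝ)+1)) (b := (n:ℝ)+1) (fun t _ => (hK t).lipschitzOnWith)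
      ⟨by linarith, by linarith⟩ (fun t ht => ⟨hβ n t ht, trivial⟩)
      (fun t ht => ⟨hβ N t ⟨by linarith [ht.1], by linarith [ht.2]⟩, trivial⟩)
      (by rw [hβ0, hβ0]) ht
  refine ⟨fun t => β ⌈|t|⌉₊ t, hβ0 _, fun t => ?_⟩
  set N := ⌈|t|⌉₊ + 1 with hN
  have htN : |t| < N := by
    have := Nat.le_ceil |t|
    push_cast [hN]; linarith
  have hag : ∀ s : ℝ, |s| < N → β ⌈|s|⌉₊ s = β N s := by
    intro s hs
    have h1 : ⌈|s|⌉₊ ≤ N := Nat.ceil_le.2 hs.le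
    have h2 := Nat.le_ceil |s|
    refine agree _ _ h1 s ?_
    rw [mem_Ioo, ← abs_lt]; linarith
  have hev : (fun s => β ⌈|s|⌉₊ s) =ᶠ[𝓝 t] β N := by
    have : ∀ᶠ s : ℝ in 𝓝 t, |s| < (N:ℝ) := (continuous_abs.tendsto t).eventually (gt_mem_nhds htN)
    filter_upwards [this] with s hs using hag s hs
  have hd := hβ N t (by rw [mem_Ioo, ← abs_lt]; linarith)
  have := hd.congr_of_eventuallyEq hev
  simpa only [hag t htN] using this

theorem upl_exp_lip (B x y : ℝ) :
    |Real.exp (min x B) - Real.exp (min y B)| ≤ Real.exp B * |x - y| := by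
  have h : LipschitzOnWith (Real.exp B).toNNReal Real.exp (Iic B) := by
    apply (convex_Iic B).lipschitzOnWith_of_nnnorm_deriv_le
      (fun x _ => Real.differentiableAt_exp)
    intro x hx
    rw [Real.deriv_exp, ← NNReal.coe_le_coe, coe_nnnorm, Real.norm_eq_abs, Real.abs_exp,
      Real.coe_toNNReal _ (Real.exp_pos B).le]
    exact Real.exp_le_exp.2 hx
  have h1 := h.dist_le_mul (min x B) (min_le_right x B) (min y B) (min_le_right y B)
  rw [Real.dist_eq, Real.dist_eq, Real.coe_toNNReal _ (Real.exp_pos B).le] at h1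
  refine h1.trans (mul_le_mul_of_nonneg_left ?_ (Real.exp_pos B).le)
  have := abs_min_sub_min_le_max x B y B
  simpa using this

/-- uniqueness for the planar system, with an upper bound on `q`. -/
theorem upl_pq_unique (a b B t₀ : ℝ) (p q p' q' : ℝ → ℝ)
    (hp : ∀ t, HasDerivAt p (-a * (Real.exp (q t) - 1)) t)
    (hq : ∀ t, HasDerivAt q (b * p t) t)
    (hp' : ∀ t, HasDerivAt p' (-a * (Real.exp (q' t) - 1)) t)
    (hq' : ∀ t, HasDerivAt q' (b * p' t) t)
    (hB : ∀ t, q t ≤ B) (hB' : ∀ t, q' t ≤ B)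
    (h1 : p t₀ = p' t₀) (h2 : q t₀ = q' t₀) : p = p' ∧ q = q' := by
  let v : ℝ → ℝ × ℝ → ℝ × ℝ := fun _ x => (-a * (Real.exp (min x.2 B) - 1), b * x.1)
  have hv : ∀ t, LipschitzWith (|a| * Real.exp B + |b|).toNNReal (v t) := by
    intro t
    apply LipschitzWith.of_dist_le_mul
    intro x y
    have hnn : 0 ≤ |a| * Real.exp B + |b| := by positivity
    rw [Real.coe_toNNReal _ hnn, Prod.dist_eq, Prod.dist_eq]
    simp only [v, Real.dist_eq]
    have e1 := upl_exp_lip B x.2 y.2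
    have m1 := le_max_left |x.1 - y.1| |x.2 - y.2|
    have m2 := le_max_right |x.1 - y.1| |x.2 - y.2|
    set m := max |x.1 - y.1| |x.2 - y.2|
    have m0 : 0 ≤ m := (abs_nonneg _).trans m1
    apply max_le
    · rw [show -a * (Real.exp (min x.2 B) - 1) - -a * (Real.exp (min y.2 B) - 1)
        = -a * (Real.exp (min x.2 B) - Real.exp (min y.2 B)) by ring, abs_mul, abs_neg]
      calc |a| * |Real.exp (min x.2 B) - Real.exp (min y.2 B)| ≤ |a| * (Real.exp B * m) := by
            gcongr; exact e1.trans (by gcongr)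
        _ ≤ _ := by nlinarith [mul_nonneg (abs_nonneg b) m0]
    · rw [← mul_sub, abs_mul]
      have : |b| * |x.1 - y.1| ≤ |b| * m := by gcongr
      nlinarith [mul_nonneg (mul_nonneg (abs_nonneg a) (Real.exp_pos B).le) m0]
  have := ODE_solution_unique_univ (v := v) (s := fun _ => univ)
    (f := fun t => (p t, q t)) (g := fun t => (p' t, q' t)) (t₀ := t₀)
    (fun t => (hv t).lipschitzOnWith)
    (fun t => ⟨by simpa [v, min_eq_left (hB t)] using (hp t).prodMk (hq t), trivial⟩)
    (fun t => ⟨by simpa [v, min_eq_left (hB' t)] using (hp' t).prodMk (hq' t), trivial⟩)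
    (by simp [h1, h2])
  constructor <;> ext t
  · exact congrArg Prod.fst (congrFun this t)
  · exact congrArg Prod.snd (congrFun this t)

theorem upl_antideriv (f : ℝ → ℝ) (hf : Continuous f) (h1 : ∀ x, 0 ≤ x → 0 ≤ f x)
    (h2 : ∀ x, x ≤ 0 → f x ≤ 0) :
    ∃ F : ℝ → ℝ, F 0 = 0 ∧ (∀ x, HasDerivAt F (f x) x) ∧ (∀ x, 0 ≤ F x) ∧
      MonotoneOn F (Ici 0) ∧ AntitoneOn F (Iic 0) := by
  have hd : ∀ x, HasDerivAt (fun x => ∫ s in (0:ℝ)..x, f s) (f x) x := fun x =>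
    intervalIntegral.integral_hasDerivAt_right (hf.intervalIntegrable _ _)
      hf.aestronglyMeasurable.stronglyMeasurableAtFilter hf.continuousAt
  set F := fun x => ∫ s in (0:ℝ)..x, f s with hF
  have h0 : F 0 = 0 := by simp [hF]
  have hcont : Continuous F := continuous_iff_continuousAt.2 fun x => (hd x).continuousAt
  have hm : MonotoneOn F (Ici 0) := by
    apply monotoneOn_of_hasDerivWithinAt_nonneg (convex_Ici 0) hcont.continuousOn
      (f' := f) (fun x _ => (hd x).hasDerivWithinAt)
    intro x hx; rw [interior_Ici] at hx; exact h1 x (le_of_lt hx)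
  have ha : AntitoneOn F (Iic 0) := by
    apply antitoneOn_of_hasDerivWithinAt_nonpos (convex_Iic 0) hcont.continuousOn
      (f' := f) (fun x _ => (hd x).hasDerivWithinAt)
    intro x hx; rw [interior_Iic] at hx; exact h2 x (le_of_lt hx)
  refine ⟨F, h0, hd, fun x => ?_, hm, ha⟩
  rcases le_total 0 x with h | h
  · rw [← h0]; exact hm self_mem_Ici h h
  · rw [← h0]; exact ha h self_mem_Iic h

theorem upl_pq_exists (a b q₀ : ℝ) (ha : 0 < a) (hb : 0 < b) (hq₀ : 0 < q₀) :
    ∃ p q : ℝ → ℝ, p 0 = 0 ∧ q 0 = q₀ ∧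
      (∀ t, HasDerivAt p (-a * (Real.exp (q t) - 1)) t) ∧
      (∀ t, HasDerivAt q (b * p t) t) ∧ ∀ t, q t ≤ q₀ := by
  obtain ⟨F, hF0, hFd, hFn, hFm, hFa⟩ := upl_antideriv (fun x => Real.exp (min x q₀) - 1)
    (by fun_prop)
    (fun x hx => by
      have : 0 ≤ min x q₀ := le_min hx hq₀.le
      have := Real.one_le_exp this
      linarith)
    (fun x hx => by
      have : min x q₀ ≤ 0 := (min_le_left _ _).trans hx
      have := Real.exp_le_one_iff.2 this
      linarith)
  obtain ⟨R, hR⟩ : ∃ R, R = 1 + 2 * a * F q₀ / b := ⟨_, rfl⟩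
  have hR1 : 1 ≤ R := by
    have : 0 ≤ 2 * a * F q₀ / b := by have := hFn q₀; positivity
    linarith
  have hRb : a * F q₀ < b * (R ^ 2 / 2) := by
    have h1 : b * R = b + 2 * a * F q₀ := by rw [hR]; field_simp
    nlinarith [mul_nonneg hb.le (mul_nonneg (by linarith : (0:ℝ) ≤ R) (sub_nonneg.2 hR1))]
  let φ : ℝ → ℝ := fun x => max (-R) (min x R)
  have hφc : Continuous φ := by fun_prop
  have hφe : ∀ x, |x| ≤ R → φ x = x := by
    intro x hx
    rw [abs_le] at hx
    simp only [φ]; rw [min_eq_left hx.2, max_eq_right hx.1]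
  have hφb : ∀ x, |φ x| ≤ R := by
    intro x
    rw [abs_le]
    exact ⟨le_max_left _ _, max_le (by linarith) (min_le_right _ _)⟩
  have hφl : ∀ x y, |φ x - φ y| ≤ |x - y| := by
    intro x y
    have h1 := abs_max_sub_max_le_max (-R) (min x R) (-R) (min y R)
    have h2 := abs_min_sub_min_le_max x R y R
    simp at h1 h2
    exact h1.trans h2
  obtain ⟨G, hG0, hGd, hGn, hGm, hGa⟩ := upl_antideriv φ hφc
    (fun x hx => le_max_of_le_right (le_min hx (by linarith)))
    (fun x hx => max_le (by linarith) ((min_le_left _ _).trans hx))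
  have hGc : Continuous G := continuous_iff_continuousAt.2 fun x => (hGd x).continuousAt
  have hdd : ∀ x, HasDerivAt (fun x => G x - x ^ 2 / 2) (φ x - x) x := by
    intro x
    have := (hGd x).sub (((hasDerivAt_id x).pow 2).div_const 2)
    exact HasDerivAt.congr_deriv this (by simp)
  have hGR : ∀ x, R ≤ |x| → R ^ 2 / 2 ≤ G x := by
    intro x hx
    rcases le_total 0 x with h | h
    · rw [abs_of_nonneg h] at hx
      have h1 : MonotoneOn (fun x => G x - x ^ 2 / 2) (Icc 0 R) := by
        apply monotoneOn_of_hasDerivWithinAt_nonneg (convex_Icc 0 R) (by fun_prop)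
          (f' := fun x => φ x - x) (fun x _ => (hdd x).hasDerivWithinAt)
        intro y hy
        rw [interior_Icc] at hy
        rw [hφe y (abs_le.2 ⟨by linarith [hy.1], hy.2.le⟩)]; simp
      have h2 := h1 (left_mem_Icc.2 (by linarith)) (right_mem_Icc.2 (by linarith)) (by linarith)
      have h3 := hGm (show R ∈ Ici 0 from by simp; linarith) h hx
      simp only [hG0] at h2
      linarith
    · rw [abs_of_nonpos h] at hx
      have h1 : AntitoneOn (fun x => G x - x ^ 2 / 2) (Icc (-R) 0) := by
        apply antitoneOn_of_hasDerivWithinAt_nonpos (convex_Icc _ _) (by fun_prop)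
          (f' := fun x => φ x - x) (fun x _ => (hdd x).hasDerivWithinAt)
        intro y hy
        rw [interior_Icc] at hy
        rw [hφe y (abs_le.2 ⟨hy.1.le, by linarith [hy.2]⟩)]; simp
      have h2 := h1 (left_mem_Icc.2 (by linarith)) (right_mem_Icc.2 (by linarith)) (by linarith)
      have h3 := hGa h (show -R ∈ Iic 0 from by simp; linarith) (by linarith)
      simp only [hG0] at h2
      linarith
  let v : ℝ → ℝ × ℝ → ℝ × ℝ := fun _ x => (-a * (Real.exp (min x.2 q₀) - 1), b * φ x.1)
  have hv : ∀ t, LipschitzWith (a * Real.exp q₀ + b).toNNReal (v t) := by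
    intro t
    apply LipschitzWith.of_dist_le_mul
    intro x y
    have hnn : 0 ≤ a * Real.exp q₀ + b := by positivity
    rw [Real.coe_toNNReal _ hnn, Prod.dist_eq, Prod.dist_eq]
    simp only [v, Real.dist_eq]
    have e1 := upl_exp_lip q₀ x.2 y.2
    have m1 := le_max_left |x.1 - y.1| |x.2 - y.2|
    have m2 := le_max_right |x.1 - y.1| |x.2 - y.2|
    set m := max |x.1 - y.1| |x.2 - y.2|
    have m0 : 0 ≤ m := (abs_nonneg _).trans m1
    apply max_le
    · rw [show -a * (Real.exp (min x.2 q₀) - 1) - -a * (Real.exp (min y.2 q₀) - 1)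
        = -a * (Real.exp (min x.2 q₀) - Real.exp (min y.2 q₀)) by ring, abs_mul, abs_neg,
        abs_of_pos ha]
      calc a * |Real.exp (min x.2 q₀) - Real.exp (min y.2 q₀)| ≤ a * (Real.exp q₀ * m) := by
            gcongr; exact e1.trans (by gcongr)
        _ ≤ _ := by nlinarith [mul_nonneg hb.le m0]
    · rw [← mul_sub, abs_mul, abs_of_pos hb]
      have : b * |φ x.1 - φ y.1| ≤ b * m := by gcongr; exact (hφl _ _).trans m1
      nlinarith [mul_nonneg (mul_nonneg ha.le (Real.exp_pos q₀).le) m0]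
  obtain ⟨γ, hγ0, hγ⟩ := upl_global v _ (a * (Real.exp q₀ + 1) + b * R).toNNReal hv
    (fun x => continuous_const) (by
      intro t x
      rw [Real.coe_toNNReal _ (by positivity), Prod.norm_def]
      have hE : Real.exp (min x.2 q₀) ≤ Real.exp q₀ := Real.exp_le_exp.2 (min_le_right _ _)
      have hE0 := Real.exp_pos (min x.2 q₀)
      apply max_le
      · simp only [v, Real.norm_eq_abs, abs_mul, abs_neg, abs_of_pos ha]
        have : |Real.exp (min x.2 q₀) - 1| ≤ Real.exp q₀ + 1 := by
          rw [abs_le]; constructor <;> linarith [Real.exp_pos q₀]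
        have : a * |Real.exp (min x.2 q₀) - 1| ≤ a * (Real.exp q₀ + 1) := by gcongr
        have : 0 ≤ b * R := by positivity
        linarith
      · simp only [v, Real.norm_eq_abs, abs_mul, abs_of_pos hb]
        have : b * |φ x.1| ≤ b * R := by gcongr; exact hφb _
        have : 0 ≤ a * (Real.exp q₀ + 1) := by positivity
        linarith) (0, q₀)
  have hp : ∀ t, HasDerivAt (fun t => (γ t).1) (-a * (Real.exp (min (γ t).2 q₀) - 1)) t :=
    fun t => (hasFDerivAt_fst (𝕜 := ℝ) (p := γ t)).comp_hasDerivAt t (hγ t)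
  have hq : ∀ t, HasDerivAt (fun t => (γ t).2) (b * φ (γ t).1) t :=
    fun t => (hasFDerivAt_snd (𝕜 := ℝ) (p := γ t)).comp_hasDerivAt t (hγ t)
  have hH : ∀ t, HasDerivAt (fun t => b * G (γ t).1 + a * F (γ t).2) 0 t := by
    intro t
    have h1 := ((hGd (γ t).1).comp t (hp t)).const_mul b
    have h2 := ((hFd (γ t).2).comp t (hq t)).const_mul a
    have := h1.add h2
    exact HasDerivAt.congr_deriv this (by ring)
  have hHc : ∀ t, b * G (γ t).1 + a * F (γ t).2 = a * F q₀ := by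
    intro t
    have := is_const_of_deriv_eq_zero (fun t => (hH t).differentiableAt) (fun t => (hH t).deriv) t 0
    simpa [hγ0, hG0] using this
  have hpR : ∀ t, |(γ t).1| ≤ R := by
    intro t
    by_contra! h
    have h1 := hGR _ h.le
    have h2 := hHc t
    have h3 := hFn (γ t).2
    have : b * (R ^ 2 / 2) ≤ b * G (γ t).1 := by gcongr
    nlinarith [mul_nonneg ha.le h3]
  have hqB : ∀ t, (γ t).2 ≤ q₀ := by
    intro t
    by_contra! h
    have h2 := hHc t
    have h3 := mul_nonneg hb.le (hGn (γ t).1)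
    have hFc : Continuous F := continuous_iff_continuousAt.2 fun x => (hFd x).continuousAt
    have hs : StrictMonoOn F (Ici q₀) := by
      apply strictMonoOn_of_hasDerivWithinAt_pos (convex_Ici q₀) hFc.continuousOn
        (fun x _ => (hFd x).hasDerivWithinAt)
      intro x hx
      rw [interior_Ici] at hx
      rw [min_eq_right (le_of_lt hx)]
      have := Real.one_lt_exp_iff.2 hq₀
      linarith
    have h4 := hs self_mem_Ici h.le h
    have := mul_lt_mul_of_pos_left h4 ha
    linarith
  refine ⟨fun t => (γ t).1, fun t => (γ t).2, by simp [hγ0], by simp [hγ0], fun t => ?_,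
    fun t => ?_, hqB⟩
  · have := hp t; rwa [min_eq_left (hqB t)] at this
  · have := hq t; rwa [hφe _ (hpR t)] at this

theorem upl_pq_zero (a b q₀ : ℝ) (ha : 0 < a) (hb : 0 < b) (hq₀ : 0 < q₀) (p q : ℝ → ℝ)
    (hp0 : p 0 = 0) (hq0 : q 0 = q₀)
    (hp : ∀ t, HasDerivAt p (-a * (Real.exp (q t) - 1)) t)
    (hq : ∀ t, HasDerivAt q (b * p t) t) : ∃ t₁ > 0, p t₁ = 0 := by
  have hpc : Continuous p := continuous_iff_continuousAt.2 fun x => (hp x).continuousAt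
  have hqc : Continuous q := continuous_iff_continuousAt.2 fun x => (hq x).continuousAt
  by_contra! hne
  -- p is negative right after zero
  obtain ⟨ε, hε, hpε⟩ : ∃ ε > 0, ∀ t ∈ Ioc 0 ε, p t < 0 := by
    have hev : ∀ᶠ t in 𝓝 (0:ℝ), 0 < q t :=
      (hqc.tendsto 0).eventually (lt_mem_nhds (by rw [hq0]; exact hq₀))
    obtain ⟨ε, hε, h⟩ := Metric.eventually_nhds_iff.1 hev
    have hs : StrictAntiOn p (Icc 0 (ε / 2)) := by
      apply strictAntiOn_of_hasDerivWithinAt_neg (convex_Icc _ _) hpc.continuousOn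
        (fun x _ => (hp x).hasDerivWithinAt)
      intro x hx
      rw [interior_Icc] at hx
      have hqx : 0 < q x := h (by
        rw [Real.dist_eq, sub_zero, abs_of_pos hx.1]; linarith [hx.2])
      have := Real.one_lt_exp_iff.2 hqx
      nlinarith
    refine ⟨ε / 2, by linarith, fun t ht => ?_⟩
    rw [← hp0]
    exact hs (left_mem_Icc.2 (by linarith)) ⟨ht.1.le, ht.2⟩ ht.1
  have hpn : ∀ t, 0 < t → p t < 0 := by
    intro t ht
    by_contra! h
    rcases le_total t ε with h' | h'
    · exact absurd (hpε t ⟨ht, h'⟩) (not_lt.2 h)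
    · obtain ⟨s, hs, hs0⟩ := intermediate_value_Icc h' hpc.continuousOn
        (show (0:ℝ) ∈ Icc (p ε) (p t) from ⟨(hpε ε ⟨hε, le_rfl⟩).le, h⟩)
      exact hne s (by linarith [hs.1]) hs0
  have hqa : StrictAntiOn q (Ici 0) := by
    apply strictAntiOn_of_hasDerivWithinAt_neg (convex_Ici _) hqc.continuousOn
      (fun x _ => (hq x).hasDerivWithinAt)
    intro x hx
    rw [interior_Ici] at hx
    have := hpn x hx
    nlinarith
  by_cases hcase : ∀ t, 0 < t → 0 < q t
  · have hpa : AntitoneOn p (Ici 0) := by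
      apply antitoneOn_of_hasDerivWithinAt_nonpos (convex_Ici _) hpc.continuousOn
        (fun x _ => (hp x).hasDerivWithinAt)
      intro x hx
      rw [interior_Ici] at hx
      have := Real.one_lt_exp_iff.2 (hcase x hx)
      nlinarith
    have hp1 := hpn 1 one_pos
    have hmon : AntitoneOn (fun t => q t - b * p 1 * t) (Ici 1) := by
      apply antitoneOn_of_hasDerivWithinAt_nonpos (convex_Ici _) (by fun_prop)
        (fun x _ => ((hq x).sub ((hasDerivAt_id x).const_mul (b * p 1))).hasDerivWithinAt)
      intro x hx
      rw [interior_Ici] at hx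
      have hx' : (1:ℝ) < x := hx
      have : p x ≤ p 1 := hpa (by simp) (by simp; linarith) hx'.le
      nlinarith
    have hbp : b * p 1 < 0 := by nlinarith
    have hq1 := hcase 1 one_pos
    obtain ⟨c, hc⟩ : ∃ c, c = q 1 / (-(b * p 1)) := ⟨_, rfl⟩
    have hc0 : 0 < c := by rw [hc]; apply div_pos hq1; linarith
    have hcm : b * p 1 * c = - q 1 := by
      have := hbp.ne; rw [hc, div_neg, mul_neg, mul_div_cancel₀ _ this]
    have h := hmon (show (1:ℝ) ∈ Ici 1 from self_mem_Ici)
      (show 1 + c ∈ Ici (1:ℝ) by simp; linarith) (by linarith)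
    have h' := hcase (1 + c) (by linarith)
    simp only at h
    nlinarith
  · push Not at hcase
    obtain ⟨s, hs, hqs⟩ := hcase
    set u := s + 1 with hu
    have hqu : q u < 0 := lt_of_lt_of_le (hqa (by simp; linarith) (by simp; linarith)
      (by linarith)) hqs
    have hE : Real.exp (q u) < 1 := by rw [← Real.exp_zero]; exact Real.exp_lt_exp.2 hqu
    set c := a * (1 - Real.exp (q u)) with hc
    have hc0 : 0 < c := by apply mul_pos ha; linarith
    have hmon : MonotoneOn (fun t => p t - c * t) (Ici u) := by
      apply monotoneOn_of_hasDerivWithinAt_nonneg (convex_Ici _) (by fun_prop)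
        (fun x _ => ((hp x).sub ((hasDerivAt_id x).const_mul c)).hasDerivWithinAt)
      intro x hx
      rw [interior_Ici] at hx
      have hx' : u < x := hx
      have h1 : q x ≤ q u := (hqa (by simp; linarith) (by simp; linarith) hx').le
      have h2 := Real.exp_le_exp.2 h1
      rw [hc]
      nlinarith
    have hpu := hpn u (by linarith)
    obtain ⟨d, hd⟩ : ∃ d, d = -p u / c := ⟨_, rfl⟩
    have hd0 : 0 < d := by rw [hd]; apply div_pos _ hc0; linarith
    have hcd : c * d = -p u := by rw [hd]; field_simp
    have h := hmon (show u ∈ Ici u from self_mem_Ici)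
      (show u + d ∈ Ici u by simp; linarith) (by linarith)
    have h' := hpn (u + d) (by linarith)
    simp only at h
    nlinarith

theorem upl_pq_periodic (a b q₀ : ℝ) (ha : 0 < a) (hb : 0 < b) (hq₀ : 0 < q₀) (p q : ℝ → ℝ)
    (hp0 : p 0 = 0) (hq0 : q 0 = q₀)
    (hp : ∀ t, HasDerivAt p (-a * (Real.exp (q t) - 1)) t)
    (hq : ∀ t, HasDerivAt q (b * p t) t) (hB : ∀ t, q t ≤ q₀) :
    ∃ T > 0, ∀ t, p (t + T) = p t ∧ q (t + T) = q t := by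
  obtain ⟨t₁, ht₁, hpt⟩ := upl_pq_zero a b q₀ ha hb hq₀ p q hp0 hq0 hp hq
  have refl : ∀ c, p c = 0 → ∀ t, p (2 * c - t) = - p t ∧ q (2 * c - t) = q t := by
    intro c hc
    have := upl_pq_unique a b q₀ c (fun t => - p (2 * c - t)) (fun t => q (2 * c - t)) p q
      (fun t => by
        have := ((hp (2 * c - t)).comp_const_sub (2 * c) t).neg
        exact HasDerivAt.congr_deriv this (by ring))
      (fun t => by
        have := ((hq (2 * c - t)).comp_const_sub (2 * c) t)
        simpa using this)
      hp hq (fun t => hB _) hB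
      (by simp [show 2 * c - c = c by ring, hc]) (by simp [show 2 * c - c = c by ring])
    intro t
    have h1 := congrFun this.1 t
    have h2 := congrFun this.2 t
    exact ⟨by linarith, h2⟩
  refine ⟨2 * t₁, by linarith, fun t => ?_⟩
  have h1 := refl 0 hp0 t
  have h2 := refl t₁ hpt (-t)
  simp only [mul_zero, zero_sub, sub_neg_eq_add] at h1 h2
  rw [add_comm t, h2.1, h2.2, h1.1, h1.2]
  simp

theorem upl_exp_mono (C x y : ℝ) (hx : x ≤ C) (hy : y ≤ C) :
    (x - y) * (Real.exp (-x) - Real.exp (-y)) ≤ -Real.exp (-C) * (x - y) ^ 2 := by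
  have key : ∀ x y : ℝ, x ≤ C → y ≤ x →
      (x - y) * (Real.exp (-x) - Real.exp (-y)) ≤ -Real.exp (-C) * (x - y) ^ 2 := by
    intro x y hx hxy
    have h1 : Real.exp (-y) = Real.exp (-x) * Real.exp (x - y) := by
      rw [← Real.exp_add]; congr 1; ring
    have h2 := Real.add_one_le_exp (x - y)
    have h3 : Real.exp (-C) ≤ Real.exp (-x) := Real.exp_le_exp.2 (by linarith)
    have h0 : 0 ≤ x - y := sub_nonneg.2 hxy
    have h4 : Real.exp (-C) * (x - y) ≤ Real.exp (-x) * (Real.exp (x - y) - 1) :=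
      mul_le_mul h3 (by linarith) h0 (Real.exp_pos _).le
    rw [h1]
    nlinarith [mul_le_mul_of_nonneg_left h4 h0]
  rcases le_total y x with h | h
  · exact key x y hx h
  · have := key y x hy h
    nlinarith

theorem upl_r_unique (k α C : ℝ) (hα : 0 < α) (p q r s : ℝ → ℝ)
    (hr : ∀ t, HasDerivAt r (-(k * p t) + α * (Real.exp (-r t) - Real.exp (q t + r t))) t)
    (hs : ∀ t, HasDerivAt s (-(k * p t) + α * (Real.exp (-s t) - Real.exp (q t + s t))) t)
    (hrC : ∀ t, |r t| ≤ C) (hsC : ∀ t, |s t| ≤ C) : r 0 = s 0 := by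
  set c := 2 * α * Real.exp (-C) with hc
  have hc0 : 0 < c := by positivity
  have hd : ∀ t, HasDerivAt (fun t => (r t - s t) ^ 2 * Real.exp (c * t))
      ((2 * (r t - s t) * (α * ((Real.exp (-r t) - Real.exp (-s t))
        - (Real.exp (q t + r t) - Real.exp (q t + s t)))) + c * (r t - s t) ^ 2)
        * Real.exp (c * t)) t := by
    intro t
    have := (((hr t).sub (hs t)).pow 2).mul (((hasDerivAt_id t).const_mul c).exp)
    refine HasDerivAt.congr_deriv this ?_
    simp
    ring
  have hanti : Antitone (fun t => (r t - s t) ^ 2 * Real.exp (c * t)) := by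
    apply antitone_of_hasDerivAt_nonpos hd
    intro t
    apply mul_nonpos_of_nonpos_of_nonneg _ (Real.exp_pos _).le
    have h1 := upl_exp_mono C (r t) (s t) (abs_le.1 (hrC t)).2 (abs_le.1 (hsC t)).2
    have h2 : 0 ≤ (r t - s t) * (Real.exp (q t + r t) - Real.exp (q t + s t)) := by
      rcases le_total (r t) (s t) with h | h
      · have := Real.exp_le_exp.2 (add_le_add_right h (q t))
        nlinarith
      · have := Real.exp_le_exp.2 (add_le_add_right h (q t))
        nlinarith
    rw [hc]
    have h3 := mul_le_mul_of_nonneg_left h1 hα.le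
    have h4 := mul_nonneg hα.le h2
    nlinarith
  have hle : ∀ t : ℝ, 0 ≤ t → (r 0 - s 0) ^ 2 ≤ (2 * C) ^ 2 * Real.exp (-(c * t)) := by
    intro t ht
    have h1 := hanti (show -t ≤ 0 by linarith)
    simp only [mul_zero, Real.exp_zero, mul_one, mul_neg] at h1
    refine h1.trans (mul_le_mul_of_nonneg_right ?_ (Real.exp_pos _).le)
    have a1 := abs_le.1 (hrC (-t))
    have a2 := abs_le.1 (hsC (-t))
    apply sq_le_sq'
    · linarith
    · linarith
  have hlim : Tendsto (fun t : ℝ => (2 * C) ^ 2 * Real.exp (-(c * t))) atTop (𝓝 ((2 * C) ^ 2 * 0)) := by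
    apply Tendsto.const_mul
    apply Real.tendsto_exp_neg_atTop_nhds_zero.comp
    exact tendsto_id.const_mul_atTop hc0
  have h0 : (r 0 - s 0) ^ 2 ≤ 0 := by
    have := ge_of_tendsto hlim ((eventually_ge_atTop 0).mono hle)
    simpa using this
  have := pow_eq_zero_iff (two_ne_zero) |>.1 (le_antisymm h0 (sq_nonneg _))
  linarith

theorem upl_r_exists (k α A T : ℝ) (hk : 0 < k) (hα : 0 < α) (hT : 0 < T) (p q : ℝ → ℝ)
    (hpc : Continuous p) (hqc : Continuous q) (hpA : ∀ t, |p t| ≤ A) (hqA : ∀ t, |q t| ≤ A)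
    (hpT : ∀ t, p (t + T) = p t) (hqT : ∀ t, q (t + T) = q t) :
    ∃ r : ℝ → ℝ,
      (∀ t, HasDerivAt r (-(k * p t) + α * (Real.exp (-r t) - Real.exp (q t + r t))) t) ∧
      ∀ t, r (t + T) = r t := by
  have hA0 : 0 ≤ A := (abs_nonneg _).trans (hpA 0)
  obtain ⟨M, hM⟩ : ∃ M, M = A + (k * A + 1) / α := ⟨_, rfl⟩
  have hMA : α * (M - A) = k * A + 1 := by rw [hM]; field_simp; ring
  have hAM : A ≤ M := by
    have : 0 ≤ (k * A + 1) / α := by positivity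
    linarith
  have hM0 : 0 ≤ M := hA0.trans hAM
  let v : ℝ → ℝ → ℝ := fun t x =>
    -(k * p t) + α * (Real.exp (min (-x) M) - Real.exp (q t) * Real.exp (min x M))
  have hE : ∀ x, |Real.exp (min x M)| ≤ Real.exp M := fun x => by
    rw [Real.abs_exp]; exact Real.exp_le_exp.2 (min_le_right _ _)
  have hEq : ∀ t, |Real.exp (q t)| ≤ Real.exp A := fun t => by
    rw [Real.abs_exp]; exact Real.exp_le_exp.2 (abs_le.1 (hqA t)).2
  have hv : ∀ t, LipschitzWith (α * (Real.exp M + Real.exp A * Real.exp M)).toNNReal (v t) := by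
    intro t
    apply LipschitzWith.of_dist_le_mul
    intro x y
    rw [Real.coe_toNNReal _ (by positivity), Real.dist_eq, Real.dist_eq]
    have e1 := upl_exp_lip M x y
    have e2 := upl_exp_lip M (-x) (-y)
    rw [show |-x - -y| = |x - y| by rw [abs_sub_comm]; congr 1; ring] at e2
    have : v t x - v t y = α * ((Real.exp (min (-x) M) - Real.exp (min (-y) M))
      - Real.exp (q t) * (Real.exp (min x M) - Real.exp (min y M))) := by simp only [v]; ring
    rw [this, abs_mul, abs_of_pos hα, mul_assoc]
    apply mul_le_mul_of_nonneg_left _ hα.le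
    refine (abs_sub _ _).trans ?_
    rw [abs_mul, add_mul]
    apply add_le_add e2
    rw [mul_assoc]
    exact mul_le_mul (hEq t) e1 (abs_nonneg _) (Real.exp_pos _).le
  have hex := upl_global v _ (k * A + α * (Real.exp M + Real.exp A * Real.exp M)).toNNReal hv
    (fun x => by simp only [v]; fun_prop) (by
      intro t x
      rw [Real.coe_toNNReal _ (by positivity), Real.norm_eq_abs]
      refine (abs_add_le _ _).trans (add_le_add ?_ ?_)
      · rw [abs_neg, abs_mul, abs_of_pos hk]
        exact mul_le_mul_of_nonneg_left (hpA t) hk.le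
      · rw [abs_mul, abs_of_pos hα]
        apply mul_le_mul_of_nonneg_left _ hα.le
        refine (abs_sub _ _).trans ?_
        rw [abs_mul]
        exact add_le_add (hE _) (mul_le_mul (hEq t) (hE _) (abs_nonneg _) (Real.exp_pos _).le))
  choose ρ hρ0 hρ using hex
  -- strict inflow at the boundary
  have hup : ∀ t, v t M < 0 := by
    intro t
    simp only [v, min_self]
    rw [min_eq_left (by linarith), ← Real.exp_add]
    have h1 : Real.exp (-M) ≤ 1 := Real.exp_le_one_iff.2 (by linarith)
    have h2 := Real.add_one_le_exp (q t + M)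
    have h3 := (abs_le.1 (hqA t)).1
    have h4 := (abs_le.1 (hpA t)).1
    nlinarith
  have hlo : ∀ t, 0 < v t (-M) := by
    intro t
    simp only [v, neg_neg, min_self]
    rw [min_eq_left (by linarith), ← Real.exp_add]
    have h1 : Real.exp (q t + -M) ≤ 1 :=
      Real.exp_le_one_iff.2 (by linarith [(abs_le.1 (hqA t)).2])
    have h2 := Real.add_one_le_exp M
    have h4 := (abs_le.1 (hpA t)).2
    nlinarith
  have hρc : ∀ x, Continuous (ρ x) := fun x =>
    continuous_iff_continuousAt.2 fun t => (hρ x t).continuousAt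
  have inv : ∀ x ∈ Icc (-M) M, ∀ t, 0 ≤ t → ρ x t ∈ Icc (-M) M := by
    intro x hx t ht
    constructor
    · have := image_le_of_deriv_right_lt_deriv_boundary (f := fun t => - ρ x t)
        (f' := fun t => - v t (ρ x t)) (a := 0) (b := t) (B := fun _ => M) (B' := fun _ => 0)
        (hρc x).neg.continuousOn (fun s _ => (hρ x s).neg.hasDerivWithinAt)
        (by simp only [hρ0]; linarith [hx.1]) (fun s => hasDerivAt_const _ _)
        (fun s _ h => by
          have : ρ x s = -M := by linarith
          have := hlo s
          simp_all) (right_mem_Icc.2 ht)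
      linarith
    · exact image_le_of_deriv_right_lt_deriv_boundary (f := ρ x)
        (f' := fun t => v t (ρ x t)) (a := 0) (b := t) (B := fun _ => M) (B' := fun _ => 0)
        (hρc x).continuousOn (fun s _ => (hρ x s).hasDerivWithinAt)
        (by simp only [hρ0]; linarith [hx.2]) (fun s => hasDerivAt_const _ _)
        (fun s _ h => by rw [h]; exact hup s) (right_mem_Icc.2 ht)
  have nonexp : ∀ x y, |ρ x T - ρ y T| ≤ |x - y| := by
    intro x y
    have hd : ∀ t, HasDerivAt (fun t => (ρ x t - ρ y t) ^ 2)
        (2 * (ρ x t - ρ y t) * (v t (ρ x t) - v t (ρ y t))) t := by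
      intro t
      refine HasDerivAt.congr_deriv (((hρ x t).sub (hρ y t)).pow 2) ?_
      simp
    have hanti : Antitone (fun t => (ρ x t - ρ y t) ^ 2) := by
      apply antitone_of_hasDerivAt_nonpos hd
      intro t
      have vanti : ∀ a b : ℝ, a ≤ b → v t b ≤ v t a := by
        intro a b hab
        have e1 : Real.exp (min (-b) M) ≤ Real.exp (min (-a) M) :=
          Real.exp_le_exp.2 (min_le_min_right _ (by linarith))
        have e2 : Real.exp (min a M) ≤ Real.exp (min b M) :=
          Real.exp_le_exp.2 (min_le_min_right _ hab)
        simp only [v]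
        have := Real.exp_pos (q t)
        gcongr
      rcases le_total (ρ x t) (ρ y t) with h | h
      · have := vanti _ _ h
        simp only [Pi.zero_apply]
        nlinarith
      · have := vanti _ _ h
        simp only [Pi.zero_apply]
        nlinarith
    have := hanti hT.le
    simp only [hρ0] at this
    exact sq_le_sq.1 this
  have hPc : Continuous (fun x => ρ x T) := by
    have : LipschitzWith 1 (fun x => ρ x T) := by
      apply LipschitzWith.of_dist_le_mul
      intro x y
      simpa [Real.dist_eq] using nonexp x y
    exact this.continuous
  obtain ⟨x, hx, hfix⟩ := exists_mem_Icc_isFixedPt (f := fun x => ρ x T) hPc.continuousOn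
    (by linarith : -M ≤ M) (inv _ (left_mem_Icc.2 (by linarith)) T hT.le).1
    (inv _ (right_mem_Icc.2 (by linarith)) T hT.le).2
  have hfix' : ρ x T = x := hfix
  have hper : ∀ t, ρ x (t + T) = ρ x t := by
    have := ODE_solution_unique_univ (v := v) (s := fun _ => univ)
      (f := fun t => ρ x (t + T)) (g := ρ x) (t₀ := 0)
      (fun t => (hv t).lipschitzOnWith)
      (fun t => ⟨by
        have := (hρ x (t + T)).comp_add_const t T
        simpa only [v, hpT, hqT] using this, trivial⟩)
      (fun t => ⟨hρ x t, trivial⟩) (by simp [hfix', hρ0])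
    exact fun t => congrFun this t
  have hmem : ∀ t, ρ x t ∈ Icc (-M) M := by
    intro t
    obtain ⟨n, hn⟩ := exists_nat_ge (-t / T)
    have h1 : 0 ≤ t + n * T := by
      rw [div_le_iff₀ hT] at hn; linarith
    have h2 : ρ x (t + n * T) = ρ x t := (Function.Periodic.nat_mul hper n) t
    rw [← h2]
    exact inv x hx _ h1
  refine ⟨ρ x, fun t => ?_, hper⟩
  refine (hρ x t).congr_deriv ?_
  have := hmem t
  simp only [v]
  rw [min_eq_left this.2, min_eq_left (by linarith [this.1]), Real.exp_add]

theorem upl_bdd (f : ℝ → ℝ) (hf : Continuous f) (T : ℝ) (hT : 0 < T)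
    (h : ∀ t, f (t + T) = f t) : ∃ C, ∀ t, |f t| ≤ C := by
  have := Function.Periodic.isBounded_of_continuous (f := f) (c := T) h hT.ne' hf
  obtain ⟨C, hC⟩ := this.exists_norm_le
  exact ⟨C, fun t => hC _ (mem_range_self t)⟩

/-- For every q₀ > 0 there is a unique r₀ such that the solution of the transformed
system (8) with initial condition (0, q₀, r₀) is defined for all t ∈ ℝ and periodic. -/
theorem unique_periodic_lift
    (κ₁ κ₂ κ₃ κ₄ : ℝ) (hκ₁ : 0 < κ₁) (hκ₂ : 0 < κ₂) (hκ₃ : 0 < κ₃) (hκ₄ : 0 < κ₄)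
    (heq : κ₁ = κ₂ + κ₃)
    (α : ℝ) (hα : α = Real.sqrt (κ₁ * κ₃ * κ₄ / κ₂)) :
    ∀ q₀ : ℝ, 0 < q₀ →
      ∃! r₀ : ℝ, ∃ p q r : ℝ → ℝ,
        p 0 = 0 ∧ q 0 = q₀ ∧ r 0 = r₀ ∧
        (∀ t : ℝ,
          HasDerivAt p (-(2 * κ₄) * (Real.exp (q t) - 1)) t ∧
          HasDerivAt q (κ₂ * p t) t ∧
          HasDerivAt r (-(κ₁ * p t) + α * (Real.exp (-r t) - Real.exp (q t + r t))) t) ∧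
        ∃ T > (0 : ℝ), ∀ t : ℝ, p (t + T) = p t ∧ q (t + T) = q t ∧ r (t + T) = r t := by
  intro q₀ hq₀
  have hα0 : 0 < α := by rw [hα]; positivity
  obtain ⟨p, q, hp0, hq0, hp, hq, hB⟩ := upl_pq_exists (2 * κ₄) κ₂ q₀ (by positivity) hκ₂ hq₀
  obtain ⟨T, hT, hper⟩ := upl_pq_periodic (2 * κ₄) κ₂ q₀ (by positivity) hκ₂ hq₀ p q hp0 hq0 hp hq hB
  have cont : ∀ (f f' : ℝ → ℝ), (∀ t, HasDerivAt f (f' t) t) → Continuous f := fun f f' h =>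
    continuous_iff_continuousAt.2 fun t => (h t).continuousAt
  have hpc := cont _ _ hp
  have hqc := cont _ _ hq
  obtain ⟨A₁, hA₁⟩ := upl_bdd p hpc T hT fun t => (hper t).1
  obtain ⟨A₂, hA₂⟩ := upl_bdd q hqc T hT fun t => (hper t).2
  obtain ⟨r, hr, hrT⟩ := upl_r_exists κ₁ α (max A₁ A₂) T hκ₁ hα0 hT p q hpc hqc
    (fun t => (hA₁ t).trans (le_max_left _ _)) (fun t => (hA₂ t).trans (le_max_right _ _))
    (fun t => (hper t).1) (fun t => (hper t).2)
  refine ⟨r 0, ⟨p, q, r, hp0, hq0, rfl, fun t => ⟨hp t, hq t, hr t⟩, T, hT,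
    fun t => ⟨(hper t).1, (hper t).2, hrT t⟩⟩, ?_⟩
  rintro s₀ ⟨p', q', s, hp0', hq0', rfl, hode, T', hT', hper'⟩
  have hqc' := cont _ _ fun t => (hode t).2.1
  obtain ⟨B, hB'⟩ := upl_bdd q' hqc' T' hT' fun t => (hper' t).2.1
  obtain ⟨rfl, rfl⟩ := upl_pq_unique (2 * κ₄) κ₂ (max q₀ B) 0 p q p' q' hp hq
    (fun t => (hode t).1) (fun t => (hode t).2.1)
    (fun t => (hB t).trans (le_max_left _ _))
    (fun t => (le_abs_self _).trans ((hB' t).trans (le_max_right _ _)))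
    (by rw [hp0, hp0']) (by rw [hq0, hq0'])
  have hs := fun t => (hode t).2.2
  obtain ⟨C₁, hC₁⟩ := upl_bdd r (cont _ _ hr) T hT hrT
  obtain ⟨C₂, hC₂⟩ := upl_bdd s (cont _ _ hs) T' hT' fun t => (hper' t).2.2
  exact upl_r_unique κ₁ α (max C₁ C₂) hα0 p q s r hs hr
    (fun t => (hC₂ t).trans (le_max_right _ _)) (fun t => (hC₁ t).trans (le_max_left _ _))
end

section
/- Let κ₁, κ₂, κ₃, κ₄ > 0 with κ₁ = κ₂ + κ₃. Along the vector field of the mass-action system (2), the product yz is strictly decreasing whenever it is at least 2κ₄/κ₃: for all x ≥ 0, y > 0, z > 0 with yz ≥ 2κ₄/κ₃, one has z·y(κ₂x − κ₃z) + y·(z(−κ₃y − κ₁x) + 2κ₄) < 0. In particular, any solution of (2) in the nonnegative orthant with yz ≥ 2κ₄/κ₃ has (d/dt)(yz) < 0 at that time. -/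
/-- For κ₁ = κ₂ + κ₃, the product yz strictly decreases along the vector field of the
mass-action system (2) whenever yz ≥ 2κ₄/κ₃: the directional derivative of yz is
negative there, and in particular any solution in the nonnegative orthant with
yz ≥ 2κ₄/κ₃ has (d/dt)(yz) < 0 at that time. -/
theorem yz_decreasing
    (κ₁ κ₂ κ₃ κ₄ : ℝ) (hκ₁ : 0 < κ₁) (hκ₂ : 0 < κ₂) (hκ₃ : 0 < κ₃) (hκ₄ : 0 < κ₄)
    (heq : κ₁ = κ₂ + κ₃) :
    (∀ x y z : ℝ, 0 ≤ x → 0 < y → 0 < z → 2 * κ₄ / κ₃ ≤ y * z →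
      z * (y * (κ₂ * x - κ₃ * z)) + y * (z * (-(κ₃ * y) - κ₁ * x) + 2 * κ₄) < 0) ∧
    (∀ x y z : ℝ → ℝ,
      (∀ t : ℝ, HasDerivAt x (x t * (κ₁ * z t - κ₂ * y t)) t ∧
                HasDerivAt y (y t * (κ₂ * x t - κ₃ * z t)) t ∧
                HasDerivAt z (z t * (-(κ₃ * y t) - κ₁ * x t) + 2 * κ₄) t) →
      ∀ t : ℝ, 0 ≤ x t → 0 ≤ y t → 0 ≤ z t → 2 * κ₄ / κ₃ ≤ y t * z t →
        ∃ d : ℝ, d < 0 ∧ HasDerivAt (fun s => y s * z s) d t) := by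
  have key : ∀ x y z : ℝ, 0 ≤ x → 0 < y → 0 < z → 2 * κ₄ / κ₃ ≤ y * z →
      z * (y * (κ₂ * x - κ₃ * z)) + y * (z * (-(κ₃ * y) - κ₁ * x) + 2 * κ₄) < 0 := by
    intro x y z hx hy hz h
    rw [div_le_iff₀ hκ₃] at h
    have h1 : 0 ≤ κ₃ * x * y * z := by positivity
    have h2 : 0 < κ₃ * y * z * z := by positivity
    have h3 : 0 ≤ y * (y * z * κ₃ - 2 * κ₄) := mul_nonneg hy.le (by linarith)
    subst heq
    linarith
  refine ⟨key, ?_⟩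
  intro x y z hsol t hx hy hz h
  have hpos : 0 < y t * z t := lt_of_lt_of_le (by positivity) h
  have hy' : 0 < y t := lt_of_le_of_ne hy (fun e => by rw [← e] at hpos; simp at hpos)
  have hz' : 0 < z t := lt_of_le_of_ne hz (fun e => by rw [← e] at hpos; simp at hpos)
  obtain ⟨_, dy, dz⟩ := hsol t
  have hk := key (x t) (y t) (z t) hx hy' hz' h
  exact ⟨_, by linarith, dy.mul dz⟩
end

section
/- Let φ(τ) = (1/√(2π))e^{−τ²/2} and Φ(τ) = ∫_{−∞}^{τ} φ(s) ds (the standard Gaussian density and distribution function). Then the curve y(τ) = φ(τ)/Φ(τ), z(τ) = φ(τ)/Φ(τ) + τ is defined for all τ ∈ ℝ, satisfies y(τ) > 0 and z(τ) > 0 for all τ, and solves the planar system ẏ = −yz, ż = −yz + 1 on all of ℝ. -/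
open MeasureTheory

/-- With φ the standard Gaussian density and Φ the standard Gaussian distribution
function, the curve y(τ) = φ(τ)/Φ(τ), z(τ) = φ(τ)/Φ(τ) + τ is defined for all τ ∈ ℝ,
is componentwise positive, and solves ẏ = −yz, ż = −yz + 1 on all of ℝ. -/
theorem gaussian_solution
    (φ Φ : ℝ → ℝ)
    (hφ : ∀ τ, φ τ = 1 / Real.sqrt (2 * Real.pi) * Real.exp (-(τ ^ 2) / 2))
    (hΦ : ∀ τ, Φ τ = ∫ s in Set.Iic τ, φ s) :
    ∀ τ : ℝ,
      0 < φ τ / Φ τ ∧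
      0 < φ τ / Φ τ + τ ∧
      HasDerivAt (fun σ => φ σ / Φ σ)
        (-((φ τ / Φ τ) * (φ τ / Φ τ + τ))) τ ∧
      HasDerivAt (fun σ => φ σ / Φ σ + σ)
        (-((φ τ / Φ τ) * (φ τ / Φ τ + τ)) + 1) τ := by
  intro τ
  have hpos : ∀ x, 0 < φ x := fun x => by rw [hφ]; positivity
  have hfun : φ = fun x => 1 / Real.sqrt (2 * Real.pi) * Real.exp (-(1/2) * x ^ 2) := by
    funext x; rw [hφ]; congr 2; ring
  have hd : ∀ x, HasDerivAt φ (-x * φ x) x := by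
    intro x
    have h1 : HasDerivAt (fun x : ℝ => -(1/2) * x ^ 2) (-x) x := by
      have := (hasDerivAt_pow 2 x).const_mul (-(1/2) : ℝ)
      refine this.congr_deriv ?_
      norm_num
      ring
    have h2 := h1.exp.const_mul (1 / Real.sqrt (2 * Real.pi))
    rw [hfun]
    refine h2.congr_deriv ?_
    ring
  have hc : Continuous φ := continuous_iff_continuousAt.2 fun x => (hd x).continuousAt
  have hint : Integrable φ := by
    rw [hfun]
    exact (integrable_exp_neg_mul_sq (by norm_num)).const_mul _
  have hint2 : Integrable (fun x => -x * φ x) := by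
    have := ((integrable_mul_exp_neg_mul_sq (b := 1/2) (by norm_num)).const_mul
      (-(1 / Real.sqrt (2 * Real.pi))))
    refine this.congr (Filter.Eventually.of_forall fun x => ?_)
    simp only [hfun]
    ring
  have hlim : Filter.Tendsto φ Filter.atBot (nhds 0) :=
    tendsto_zero_of_hasDerivAt_of_integrableOn_Iic (a := τ) (fun x _ => hd x)
      hint2.integrableOn hint.integrableOn
  have hI : ∫ s in Set.Iic τ, -s * φ s = φ τ := by
    have := integral_Iic_of_hasDerivAt_of_tendsto' (a := τ) (fun x _ => hd x)
      hint2.integrableOn hlim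
    simpa using this
  have hΦpos : 0 < Φ τ := by
    rw [hΦ, setIntegral_pos_iff_support_of_nonneg_ae
      (Filter.Eventually.of_forall fun x => (hpos x).le) hint.integrableOn]
    have : Function.support φ = Set.univ := by
      ext x; simp [(hpos x).ne']
    simp [this]
  have hz : 0 < φ τ + τ * Φ τ := by
    have he : φ τ + τ * Φ τ = ∫ s in Set.Iic τ, (-s * φ s + τ * φ s) := by
      rw [integral_add hint2.integrableOn (hint.const_mul τ).integrableOn, hI,
        integral_const_mul, hΦ]
    rw [he, setIntegral_pos_iff_support_of_nonneg_ae]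
    · have : Set.Iio τ ⊆ Function.support (fun s => -s * φ s + τ * φ s) ∩ Set.Iic τ := by
        intro x hx
        have hx' : x < τ := hx
        refine ⟨?_, hx'.le⟩
        have : 0 < (τ - x) * φ x := mul_pos (by linarith) (hpos x)
        simp only [Function.mem_support]
        intro h
        linarith
      refine lt_of_lt_of_le ?_ (measure_mono this)
      simp
    · refine (ae_restrict_iff' measurableSet_Iic).2 (Filter.Eventually.of_forall fun x hx => ?_)
      have hx' : x ≤ τ := hx
      have : 0 ≤ (τ - x) * φ x := mul_nonneg (by linarith) (hpos x).le
      simp only [Pi.zero_apply]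
      linarith
    · exact (hint2.add (hint.const_mul τ)).integrableOn
  have hΦd : HasDerivAt Φ (φ τ) τ := by
    have h : Φ = fun x => (∫ s in (0:ℝ)..x, φ s) + Φ 0 := by
      funext x
      rw [hΦ x, hΦ 0, ← intervalIntegral.integral_Iic_sub_Iic hint.integrableOn hint.integrableOn]
      ring
    rw [h]
    exact (intervalIntegral.integral_hasDerivAt_right (hc.intervalIntegrable _ _)
      (hc.stronglyMeasurableAtFilter _ _) hc.continuousAt).add_const _
  have hy : HasDerivAt (fun σ => φ σ / Φ σ) (-((φ τ / Φ τ) * (φ τ / Φ τ + τ))) τ := by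
    have := (hd τ).fun_div hΦd hΦpos.ne'
    refine this.congr_deriv ?_
    field_simp
    ring
  refine ⟨div_pos (hpos τ) hΦpos, ?_, hy, hy.add (hasDerivAt_id τ)⟩
  have : φ τ / Φ τ + τ = (φ τ + τ * Φ τ) / Φ τ := by field_simp
  rw [this]
  exact div_pos hz hΦpos
end

section
/- Let φ(τ) = (1/√(2π))e^{−τ²/2} and Φ(τ) = ∫_{−∞}^{τ} φ(s) ds. Every complete solution of the planar system ẏ = −yz, ż = −yz + 1 (i.e., a solution defined for all τ ∈ ℝ) whose trajectory remains in the closed nonnegative quadrant {y ≥ 0, z ≥ 0} for all τ ∈ ℝ is a time shift of the solution y(τ) = φ(τ)/Φ(τ), z(τ) = φ(τ)/Φ(τ) + τ; that is, there exists s ∈ ℝ such that (y(τ), z(τ)) = (φ(τ+s)/Φ(τ+s), φ(τ+s)/Φ(τ+s) + (τ+s)) for all τ. -/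
open MeasureTheory

/-- Every complete solution of ẏ = −yz, ż = −yz + 1 whose trajectory remains in the
closed nonnegative quadrant for all times is a time shift of the solution
y(τ) = φ(τ)/Φ(τ), z(τ) = φ(τ)/Φ(τ) + τ, where φ and Φ are the standard Gaussian
density and distribution function. -/
theorem complete_nonneg_solution_is_gaussian
    (φ Φ : ℝ → ℝ)
    (hφ : ∀ τ, φ τ = 1 / Real.sqrt (2 * Real.pi) * Real.exp (-(τ ^ 2) / 2))
    (hΦ : ∀ τ, Φ τ = ∫ s in Set.Iic τ, φ s)
    (y z : ℝ → ℝ)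
    (hode : ∀ τ : ℝ,
      HasDerivAt y (-(y τ * z τ)) τ ∧
      HasDerivAt z (-(y τ * z τ) + 1) τ)
    (hnonneg : ∀ τ : ℝ, 0 ≤ y τ ∧ 0 ≤ z τ) :
    ∃ s : ℝ, ∀ τ : ℝ,
      y τ = φ (τ + s) / Φ (τ + s) ∧
      z τ = φ (τ + s) / Φ (τ + s) + (τ + s) := by
  have hφc : Continuous φ := by
    have : φ = fun τ => 1 / Real.sqrt (2 * Real.pi) * Real.exp (-(τ ^ 2) / 2) := funext hφ
    rw [this]; fun_prop
  have hφpos : ∀ τ, 0 < φ τ := by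
    intro τ; rw [hφ]; positivity
  have hφi : Integrable φ := by
    have h := (integrable_exp_neg_mul_sq (b := 1 / 2) (by norm_num)).const_mul
      (1 / Real.sqrt (2 * Real.pi))
    refine h.congr (Filter.Eventually.of_forall fun x => ?_)
    simp only [hφ]
    congr 2; ring
  have hφd : ∀ τ, HasDerivAt φ (-τ * φ τ) τ := by
    intro τ
    have h1 : HasDerivAt (fun x : ℝ => -(x ^ 2) / 2) (-τ) τ := by
      have := ((hasDerivAt_pow 2 τ).neg).div_const 2
      refine HasDerivAt.congr_deriv this ?_
      simp
      ring
    have h2 := (h1.exp).const_mul (1 / Real.sqrt (2 * Real.pi))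
    have : φ = fun τ => 1 / Real.sqrt (2 * Real.pi) * Real.exp (-(τ ^ 2) / 2) := funext hφ
    rw [this]
    refine HasDerivAt.congr_deriv h2 ?_
    ring
  have hΦsub : ∀ τ, Φ τ = Φ 0 + ∫ x in (0 : ℝ)..τ, φ x := by
    intro τ
    rw [hΦ, hΦ, ← intervalIntegral.integral_Iic_sub_Iic hφi.integrableOn hφi.integrableOn]
    ring
  have hΦd : ∀ τ, HasDerivAt Φ (φ τ) τ := by
    intro τ
    have h := (intervalIntegral.integral_hasDerivAt_right (hφc.intervalIntegrable 0 τ)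
      (hφc.stronglyMeasurableAtFilter _ _) hφc.continuousAt).const_add (Φ 0)
    have e : Φ = fun τ => Φ 0 + ∫ x in (0 : ℝ)..τ, φ x := funext hΦsub
    rw [e]
    simpa using h
  have hΦlim : Filter.Tendsto Φ Filter.atBot (nhds 0) := by
    have h := intervalIntegral_tendsto_integral_Iic (0 : ℝ) hφi.integrableOn Filter.tendsto_id
    have h2 := h.const_sub (Φ 0)
    rw [← hΦ 0, sub_self] at h2
    refine h2.congr fun τ => ?_
    rw [hΦsub τ, intervalIntegral.integral_symm]
    simp
  have hφlim : Filter.Tendsto φ Filter.atBot (nhds 0) := by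
    have h1 : Filter.Tendsto (fun x : ℝ => -(x ^ 2) / 2) Filter.atBot Filter.atBot := by
      refine Filter.tendsto_atBot_mono' _ ?_ Filter.tendsto_id
      filter_upwards [Filter.eventually_le_atBot (-2 : ℝ)] with x hx
      simp only [id]
      nlinarith
    have h2 := (Real.tendsto_exp_atBot.comp h1).const_mul (1 / Real.sqrt (2 * Real.pi))
    rw [mul_zero] at h2
    exact h2.congr fun τ => (hφ τ).symm
  have hzc : Continuous z := continuous_iff_continuousAt.2 fun τ => (hode τ).2.continuousAt
  -- z - y - τ is constant
  obtain ⟨s, hs⟩ : ∃ s, ∀ τ, z τ = y τ + (τ + s) := by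
    have hd : ∀ τ, HasDerivAt (fun τ => z τ - y τ - τ) 0 τ := by
      intro τ
      have := ((hode τ).2.sub (hode τ).1).sub (hasDerivAt_id τ)
      refine HasDerivAt.congr_deriv this ?_
      ring
    refine ⟨z 0 - y 0 - 0, fun τ => ?_⟩
    have := is_const_of_deriv_eq_zero (fun x => (hd x).differentiableAt) (fun x => (hd x).deriv) τ 0
    linarith
  have hypos : ∀ τ, 0 < y τ := by
    have hd : ∀ τ, HasDerivAt (fun τ => y τ * Real.exp (∫ x in (0 : ℝ)..τ, z x)) 0 τ := by
      intro τ
      have h := (intervalIntegral.integral_hasDerivAt_right (hzc.intervalIntegrable 0 τ)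
        (hzc.stronglyMeasurableAtFilter _ _) hzc.continuousAt)
      have := (hode τ).1.mul h.exp
      refine HasDerivAt.congr_deriv this ?_
      ring
    have hconst := is_const_of_deriv_eq_zero (fun x => (hd x).differentiableAt)
      (fun x => (hd x).deriv)
    intro τ
    refine lt_of_le_of_ne (hnonneg τ).1 fun h0 => ?_
    have h1 := hconst τ (-s - 1)
    simp only [← h0, zero_mul] at h1
    have h2 : y (-s - 1) = 0 := by
      rcases mul_eq_zero.1 h1.symm with h | h
      · exact h
      · exact absurd h (Real.exp_ne_zero _)
    have h3 := hs (-s - 1)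
    have h4 := (hnonneg (-s - 1)).2
    linarith
  have hG : ∀ τ, HasDerivAt (fun τ => φ (τ + s) / y τ - Φ (τ + s)) 0 τ := by
    intro τ
    have h1 := (hφd (τ + s)).comp_add_const τ s
    have h2 := (hΦd (τ + s)).comp_add_const τ s
    have := (h1.div (hode τ).1 (hypos τ).ne').sub h2
    refine HasDerivAt.congr_deriv this ?_
    have := (hypos τ).ne'
    rw [hs τ]
    field_simp
    ring
  have hconst := is_const_of_deriv_eq_zero (fun x => (hG x).differentiableAt)
      (fun x => (hG x).deriv)
  have hsh : Filter.Tendsto (fun τ : ℝ => τ + s) Filter.atBot Filter.atBot :=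
    Filter.tendsto_atBot_add_const_right _ s Filter.tendsto_id
  have hq : Filter.Tendsto (fun τ => φ (τ + s) / y τ) Filter.atBot (nhds 0) := by
    refine tendsto_of_tendsto_of_tendsto_of_le_of_le' tendsto_const_nhds (hφlim.comp hsh) ?_ ?_
    · exact Filter.Eventually.of_forall fun τ => (div_pos (hφpos _) (hypos _)).le
    · filter_upwards [Filter.eventually_le_atBot (-s - 1 : ℝ)] with τ hτ
      have h3 := hs τ
      have h4 := (hnonneg τ).2
      exact div_le_self (hφpos _).le (by linarith)
  have hGlim := hq.sub (hΦlim.comp hsh)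
  rw [sub_zero] at hGlim
  refine ⟨s, fun τ => ?_⟩
  have hzero : φ (τ + s) / y τ - Φ (τ + s) = 0 := by
    refine tendsto_nhds_unique (tendsto_const_nhds (f := (Filter.atBot : Filter ℝ))) (hGlim.congr fun x => ?_)
    exact hconst x τ
  have hΦe : Φ (τ + s) = φ (τ + s) / y τ := by linarith
  have hy : y τ = φ (τ + s) / Φ (τ + s) := by
    rw [hΦe]
    have := (hypos τ).ne'
    have := (hφpos (τ + s)).ne'
    field_simp
  exact ⟨hy, by rw [← hy]; exact hs τ⟩
end

section
/- Let κ₁, κ₄ > 0. The planar system ẋ = κ₁xz, ż = −κ₁xz + 2κ₄ has no complete solution remaining in the closed nonnegative quadrant: there is no solution t ↦ (x(t), z(t)) defined for all t ∈ ℝ with x(t) ≥ 0 and z(t) ≥ 0 for all t ∈ ℝ. Indeed, for every solution with x(0) ≥ 0 and z(0) ≥ 0 that extends to all negative times, there exists t* < 0 with z(t*) < 0. -/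
/-- The planar system ẋ = κ₁xz, ż = −κ₁xz + 2κ₄ has no complete solution remaining in
the closed nonnegative quadrant; indeed, every solution with x(0) ≥ 0 and z(0) ≥ 0 that
extends to all negative times satisfies z(t*) < 0 for some t* < 0. -/
theorem no_complete_nonneg_solution
    (κ₁ κ₄ : ℝ) (hκ₁ : 0 < κ₁) (hκ₄ : 0 < κ₄) :
    (¬ ∃ x z : ℝ → ℝ,
      (∀ t : ℝ, HasDerivAt x (κ₁ * x t * z t) t ∧
                HasDerivAt z (-(κ₁ * x t * z t) + 2 * κ₄) t) ∧
      (∀ t : ℝ, 0 ≤ x t ∧ 0 ≤ z t)) ∧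
    (∀ x z : ℝ → ℝ,
      (∀ t ≤ (0 : ℝ), HasDerivAt x (κ₁ * x t * z t) t ∧
                      HasDerivAt z (-(κ₁ * x t * z t) + 2 * κ₄) t) →
      0 ≤ x 0 → 0 ≤ z 0 → ∃ t < (0 : ℝ), z t < 0) := by
  have main : ∀ x z : ℝ → ℝ,
      (∀ t ≤ (0 : ℝ), HasDerivAt x (κ₁ * x t * z t) t ∧
                      HasDerivAt z (-(κ₁ * x t * z t) + 2 * κ₄) t) →
      0 ≤ x 0 → 0 ≤ z 0 → ∃ t < (0 : ℝ), z t < 0 := by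
    intro x z h hx0 hz0
    by_contra! hz
    have mono : ∀ (f f' : ℝ → ℝ), (∀ t ≤ (0 : ℝ), HasDerivAt f (f' t) t) →
        (∀ t < (0 : ℝ), 0 ≤ f' t) → MonotoneOn f (Set.Iic 0) := by
      intro f f' hf hf'
      refine monotoneOn_of_deriv_nonneg (convex_Iic 0) ?_ ?_ ?_
      · intro t ht
        exact (hf t ht).continuousAt.continuousWithinAt
      · intro t ht
        rw [interior_Iic] at ht
        exact (hf t (le_of_lt ht)).differentiableAt.differentiableWithinAt
      · intro t ht
        rw [interior_Iic] at ht
        rw [(hf t (le_of_lt ht)).deriv]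
        exact hf' t ht
    have m1 := mono (fun t => x t * x t)
      (fun t => κ₁ * x t * z t * x t + x t * (κ₁ * x t * z t))
      (fun t ht => (h t ht).1.mul (h t ht).1) (by
        intro t ht
        have h1 : 0 ≤ κ₁ * z t * (x t * x t) :=
          mul_nonneg (mul_nonneg hκ₁.le (hz t ht)) (mul_self_nonneg _)
        linarith)
    have m2 := mono (fun t => x t + z t - t * (2 * κ₄))
      (fun t => κ₁ * x t * z t + (-(κ₁ * x t * z t) + 2 * κ₄) - 1 * (2 * κ₄))
      (fun t ht => ((h t ht).1.add (h t ht).2).sub ((hasDerivAt_id' t).mul_const _)) (by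
        intro t ht
        linarith)
    have hx : ∀ s ≤ (0 : ℝ), 0 ≤ x s := by
      intro s hs
      by_contra! hxs
      have hc : ContinuousOn x (Set.Icc s 0) := fun t ht =>
        (h t ht.2).1.continuousAt.continuousWithinAt
      obtain ⟨u, hu, hxu⟩ := intermediate_value_Icc hs hc ⟨hxs.le, hx0⟩
      have := m1 (Set.mem_Iic.2 hs) (Set.mem_Iic.2 hu.2) hu.1
      simp only [hxu] at this
      nlinarith
    have hT : -((x 0 + z 0 + 1) / (2 * κ₄)) < 0 := by
      have : 0 < (x 0 + z 0 + 1) / (2 * κ₄) := by positivity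
      linarith
    have e : -((x 0 + z 0 + 1) / (2 * κ₄)) * (2 * κ₄) = -(x 0 + z 0 + 1) := by
      field_simp
    have k := m2 (Set.mem_Iic.2 hT.le) (Set.mem_Iic.2 le_rfl) hT.le
    simp only [e] at k
    have := hx _ hT.le
    have := hz _ hT
    linarith
  refine ⟨?_, main⟩
  rintro ⟨x, z, h, hn⟩
  obtain ⟨t, _, ht⟩ := main x z (fun t _ => h t) (hn 0).1 (hn 0).2
  exact absurd (hn t).2 (not_le.2 ht)
end
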